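/- arXiv:math/9910108 — 2 statements merged into one kernel-verified Lean document; each statement's English description precedes it below -/
import Mathlib

section
/- Let V₁, …, Vₙ be finitely many closed subsets of the 2-sphere S², each homeomorphic to the closed two-dimensional disk, such that ⋃ᵢ int Vᵢ is connected and S² \ ⋃ᵢ Vᵢ is nonempty. Then for every connected component W of S² \ ⋃ᵢ Vᵢ, the closure of W is homeomorphic to the closed two-dimensional disk. -/
open Metric Set

/-- The plane `ℝ²`. -/
abbrev Plane := EuclideanSpace ℝ (Fin 2)

/-- The 2-sphere, as the unit sphere in `ℝ³`. -/
abbrev Sph := Metric.sphere (0 : EuclideanSpace ℝ (Fin 3)) 1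

namespace PlaneTopology

open Filter Topology MeasureTheory

/-! ### Continuous logarithms and separation of points in the plane -/

/-- A continuous nowhere vanishing function on the plane has a continuous logarithm. -/
theorem exists_continuous_exp_eq {g : ℂ → ℂ} (hg : Continuous g) (h0 : ∀ z, g z ≠ 0) :
    ∃ L : ℂ → ℂ, Continuous L ∧ ∀ z, Complex.exp (L z) = g z := by
  have huniv : IsSimplyConnected (univ : Set ℂ) := by
    have : ContractibleSpace (univ : Set ℂ) := convex_univ.contractibleSpace univ_nonempty
    exact SimplyConnectedSpace.ofContractible _
  obtain ⟨f, hf, he⟩ := Complex.exists_continuousOn_eqOn_exp_comp huniv isOpen_univ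
    hg.continuousOn (by rintro ⟨z, -, hz⟩; exact h0 z hz)
  exact ⟨f, continuousOn_univ.1 hf, fun z => he (mem_univ z)⟩

/-- Two continuous logarithms of the same function on a preconnected set differ by a constant. -/
theorem sub_eq_of_exp_eq_one {X : Type*} [TopologicalSpace X] {s : Set X} (hs : IsPreconnected s)
    {u : X → ℂ} (hu : ContinuousOn u s) (h1 : ∀ x ∈ s, Complex.exp (u x) = 1) {x y : X}
    (hx : x ∈ s) (hy : y ∈ s) : u x = u y := by
  have key : ∀ z ∈ s, ∃ n : ℤ, u z = n * (2 * Real.pi * Complex.I) := fun z hz =>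
    Complex.exp_eq_one_iff.1 (h1 z hz)
  let v : X → ℝ := fun z => (u z).im / (2 * Real.pi)
  have hv : ContinuousOn v s := (Complex.continuous_im.comp_continuousOn hu).div_const _
  have hvint : ∀ z ∈ s, ∃ n : ℤ, v z = n ∧ u z = n * (2 * Real.pi * Complex.I) := by
    intro z hz
    obtain ⟨n, hn⟩ := key z hz
    refine ⟨n, ?_, hn⟩
    simp only [v, hn]
    have := Real.pi_ne_zero
    simp
  have hord := (hs.image v hv).ordConnected
  obtain ⟨m, hm, hm'⟩ := hvint x hx
  obtain ⟨n, hn, hn'⟩ := hvint y hy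
  have aux : ∀ {p q : ℤ}, (p : ℝ) ∈ v '' s → (q : ℝ) ∈ v '' s → ¬ p < q := by
    intro p q hp hq hlt
    have : (p : ℝ) + 1 / 2 ∈ v '' s := by
      refine hord.out hp hq ⟨by linarith, ?_⟩
      have : (p : ℝ) + 1 ≤ q := by exact_mod_cast hlt
      linarith
    obtain ⟨z, hz, hz'⟩ := this
    obtain ⟨k, hk, -⟩ := hvint z hz
    rw [hk] at hz'
    have h2 : (2 * k : ℝ) = 2 * p + 1 := by linarith
    have h3 : 2 * k = 2 * p + 1 := by exact_mod_cast h2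
    omega
  have hmn : m = n := by
    have h1 := aux (p := m) (q := n) ⟨x, hx, hm⟩ ⟨y, hy, hn⟩
    have h2 := aux (p := n) (q := m) ⟨y, hy, hn⟩ ⟨x, hx, hm⟩
    omega
  rw [hm', hn', hmn]

/-- A continuous nowhere vanishing function on the plane cannot be uniformly close to `z ↦ z - a`
on a circle around `a`. -/
theorem not_near_id_on_sphere {G : ℂ → ℂ} (hG : Continuous G) (h0 : ∀ z, G z ≠ 0) {a : ℂ} {R : ℝ}
    (hR : 0 < R) (hclose : ∀ z ∈ sphere a R, ‖G z - (z - a)‖ < R) : False := by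
  obtain ⟨L, hL, hLe⟩ := exists_continuous_exp_eq hG h0
  let c : ℝ → ℂ := fun t => a + R * Complex.exp (t * Complex.I)
  have hc : Continuous c := by fun_prop
  have hcs : ∀ t, c t ∈ sphere a R := by
    intro t
    simp [c, Complex.norm_exp_ofReal_mul_I, abs_of_pos hR]
  have hca : ∀ t, c t - a = R * Complex.exp (t * Complex.I) := by intro t; simp [c]
  have hcne : ∀ t, c t - a ≠ 0 := by
    intro t; rw [hca]; simp [hR.ne']
  have hslit : ∀ t, G (c t) / (c t - a) ∈ Complex.slitPlane := by
    intro t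
    have h1 : ‖G (c t) / (c t - a) - 1‖ < 1 := by
      have hn : ‖c t - a‖ = R := by simpa [dist_eq_norm] using hcs t
      rw [div_sub_one (hcne t), norm_div, hn, div_lt_one hR]
      exact hclose _ (hcs t)
    simpa using Complex.mem_slitPlane_of_norm_lt_one h1
  let u : ℝ → ℂ := fun t =>
    L (c t) - Complex.log (G (c t) / (c t - a)) - Complex.log R - t * Complex.I
  have hu : Continuous u := by
    have h2 : Continuous fun t => Complex.log (G (c t) / (c t - a)) :=
      Continuous.clog ((hG.comp hc).div (by fun_prop) hcne) hslit
    have h3 : Continuous fun t => L (c t) := hL.comp hc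
    fun_prop
  have hexp : ∀ t ∈ (univ : Set ℝ), Complex.exp (u t) = 1 := by
    intro t _
    have hR' : (R : ℂ) ≠ 0 := by exact_mod_cast hR.ne'
    have hd : G (c t) / (c t - a) ≠ 0 := div_ne_zero (h0 _) (hcne t)
    simp only [u]
    rw [Complex.exp_sub, Complex.exp_sub, Complex.exp_sub, hLe, Complex.exp_log hd,
      Complex.exp_log hR', div_div_eq_mul_div, mul_div_cancel_left₀ _ (h0 _), hca,
      mul_div_cancel_left₀ _ hR', div_self (Complex.exp_ne_zero _)]
  have := sub_eq_of_exp_eq_one isPreconnected_univ hu.continuousOn hexp (mem_univ 0)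
    (mem_univ (2 * Real.pi))
  have hcc : c 0 = c (2 * Real.pi) := by
    simp [c, Complex.exp_two_pi_mul_I]
  simp only [u, hcc] at this
  have h4 : (2 * Real.pi : ℂ) * Complex.I = 0 := by
    push_cast at this
    linear_combination this
  simp [Real.pi_ne_zero] at h4

/-- `HasLogQuot K a b` says that `z ↦ (z - a) / (z - b)` has a continuous logarithm on `K`. -/
def HasLogQuot (K : Set ℂ) (a b : ℂ) : Prop :=
  ∃ L : ℂ → ℂ, ContinuousOn L K ∧ ∀ z ∈ K, z - a = Complex.exp (L z) * (z - b)

theorem HasLogQuot.symm {K : Set ℂ} {a b : ℂ} (h : HasLogQuot K a b) : HasLogQuot K b a := by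
  obtain ⟨L, hL, h⟩ := h
  refine ⟨fun z => -L z, hL.neg, fun z hz => ?_⟩
  rw [h z hz, ← mul_assoc, ← Complex.exp_add]
  simp

theorem HasLogQuot.trans {K : Set ℂ} {a b c : ℂ} (h : HasLogQuot K a b) (h' : HasLogQuot K b c) :
    HasLogQuot K a c := by
  obtain ⟨L, hL, h⟩ := h
  obtain ⟨M, hM, h'⟩ := h'
  refine ⟨fun z => L z + M z, hL.add hM, fun z hz => ?_⟩
  rw [h z hz, h' z hz, Complex.exp_add, mul_assoc]

theorem hasLogQuot_of_near {K : Set ℂ} {a b : ℂ} {r : ℝ} (hK : ∀ z ∈ K, r ≤ ‖z - a‖)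
    (hab : ‖b - a‖ < r) : HasLogQuot K b a := by
  have hne : ∀ z ∈ K, z - a ≠ 0 := fun z hz h => by
    have := hK z hz
    rw [h, norm_zero] at this
    linarith [norm_nonneg (b - a)]
  have hslit : ∀ z ∈ K, (z - b) / (z - a) ∈ Complex.slitPlane := by
    intro z hz
    have h1 : ‖(a - b) / (z - a)‖ < 1 := by
      rw [norm_div, div_lt_one (norm_pos_iff.2 (hne z hz)), norm_sub_rev]
      exact hab.trans_le (hK z hz)
    have h2 := Complex.mem_slitPlane_of_norm_lt_one h1
    have h3 : (z - b) / (z - a) = 1 + (a - b) / (z - a) := by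
      field_simp [hne z hz]; ring
    rwa [h3]
  refine ⟨fun z => Complex.log ((z - b) / (z - a)), ?_, fun z hz => ?_⟩
  · exact ContinuousOn.clog (ContinuousOn.div (by fun_prop) (by fun_prop) hne) hslit
  · rw [Complex.exp_log (Complex.slitPlane_ne_zero (hslit z hz)), div_mul_cancel₀ _ (hne z hz)]

/-- Points that lie in a common connected set off a closed set `K` are not distinguished by
logarithms on `K`. -/
theorem hasLogQuot_of_isPreconnected {K O : Set ℂ} (hK : IsClosed K) (hO : IsPreconnected O)
    (hd : Disjoint O K) {a b : ℂ} (ha : a ∈ O) (hb : b ∈ O) : HasLogQuot K a b := by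
  refine hO.induction₂ (fun a b => HasLogQuot K a b) (fun x hx => ?_)
    (fun x y z _ _ _ => HasLogQuot.trans) (fun x y _ _ => HasLogQuot.symm) ha hb
  have hxK : x ∈ Kᶜ := fun h => disjoint_left.1 hd hx h
  obtain ⟨r, hr, hrK⟩ := Metric.isOpen_iff.1 hK.isOpen_compl x hxK
  have hKr : ∀ z ∈ K, r ≤ ‖z - x‖ := by
    intro z hz
    by_contra h
    exact hrK (by simpa [dist_eq_norm] using h) hz
  filter_upwards [mem_nhdsWithin_of_mem_nhds (ball_mem_nhds x hr)] with y hy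
  exact (hasLogQuot_of_near hKr (by simpa [dist_eq_norm] using hy)).symm

theorem HasLogQuot.union {A B : Set ℂ} (hA : IsClosed A) (hB : IsClosed B)
    (hAB : IsPreconnected (A ∩ B)) {a b : ℂ} (hbA : b ∉ A)
    (h : HasLogQuot A a b) (h' : HasLogQuot B a b) :
    HasLogQuot (A ∪ B) a b := by
  classical
  obtain ⟨L, hL, h⟩ := h
  obtain ⟨M, hM, h'⟩ := h'
  obtain ⟨k, hk, hk1⟩ : ∃ k : ℂ, (∀ z ∈ A ∩ B, L z = M z + k) ∧ Complex.exp k = 1 := by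
    have hexp : ∀ z ∈ A ∩ B, Complex.exp (L z - M z) = 1 := by
      intro z hz
      have hne : z - b ≠ 0 := fun h0 => hbA (by rw [← sub_eq_zero.1 h0]; exact hz.1)
      have := (h z hz.1).symm.trans (h' z hz.2)
      rw [Complex.exp_sub, mul_right_cancel₀ hne this, div_self (Complex.exp_ne_zero _)]
    rcases (A ∩ B).eq_empty_or_nonempty with he | ⟨p, hp⟩
    · exact ⟨0, by simp [he], by simp⟩
    · refine ⟨L p - M p, fun z hz => ?_, hexp p hp⟩
      have := sub_eq_of_exp_eq_one hAB (u := fun z => L z - M z)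
        ((hL.mono inter_subset_left).sub (hM.mono inter_subset_right)) hexp hz hp
      linear_combination this
  refine ⟨A.piecewise L (fun z => M z + k), ?_, ?_⟩
  · have e1 : ContinuousOn (A.piecewise L (fun z => M z + k)) A :=
      hL.congr fun z hz => by simp [hz]
    have e2 : ContinuousOn (A.piecewise L (fun z => M z + k)) B := by
      refine (hM.add continuousOn_const : ContinuousOn (fun z => M z + k) B).congr fun z hz => ?_
      by_cases hzA : z ∈ A
      · simp [hzA, hk z ⟨hzA, hz⟩]
      · simp [hzA]
    exact e1.union_of_isClosed e2 hA hB
  · rintro z hz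
    by_cases hzA : z ∈ A
    · simp [hzA, h z hzA]
    · have hzB : z ∈ B := hz.resolve_left hzA
      simp [hzA, Complex.exp_add, hk1, h' z hzB]

/-- The converse of `hasLogQuot_of_isPreconnected`, when `K` has bounded complement. -/
theorem HasLogQuot.mem_connectedComponentIn {K : Set ℂ} (hK : IsClosed K)
    (hbdd : Bornology.IsBounded Kᶜ) {a b : ℂ} (ha : a ∉ K) (hb : b ∉ K) (h : HasLogQuot K a b) :
    b ∈ connectedComponentIn Kᶜ a := by
  classical
  by_contra hbO
  obtain ⟨L, hL, hLe⟩ := h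
  set O := connectedComponentIn Kᶜ a with hOdef
  have hO : IsOpen O := hK.isOpen_compl.connectedComponentIn
  have haO : a ∈ O := _root_.mem_connectedComponentIn ha
  have hOK : O ⊆ Kᶜ := connectedComponentIn_subset _ _
  have hfr : frontier O ⊆ K := by
    intro z hz
    by_contra hzK
    have hz' : z ∈ O := by
      have hcl : IsPreconnected (insert z O) :=
        isPreconnected_connectedComponentIn.subset_closure (subset_insert _ _)
          (insert_subset hz.1 subset_closure)
      exact hcl.subset_connectedComponentIn (mem_insert_of_mem _ haO)
        (insert_subset hzK hOK) (mem_insert _ _)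
    rw [hO.frontier_eq] at hz
    exact hz.2 hz'
  obtain ⟨Lt, hLt⟩ := ContinuousMap.exists_restrict_eq (Y := ℂ) hK ⟨K.domRestrict L, hL.domRestrict⟩
  have hLt' : ∀ z ∈ K, Lt z = L z := fun z hz => by
    have := congrArg (fun f => f ⟨z, hz⟩) hLt
    simpa using this
  let G : ℂ → ℂ := O.piecewise (fun z => Complex.exp (Lt z) * (z - b)) (fun z => z - a)
  have hG : Continuous G := by
    refine Continuous.piecewise ?_ (by fun_prop) (by fun_prop)
    intro z hz
    rw [hLt' z (hfr hz), ← hLe z (hfr hz)]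
  have hG0 : ∀ z, G z ≠ 0 := by
    intro z
    by_cases hz : z ∈ O
    · have : z ≠ b := by rintro rfl; exact hbO hz
      simp [G, hz, sub_eq_zero, this]
    · have : z ≠ a := by rintro rfl; exact hz haO
      simp [G, hz, sub_eq_zero, this]
  obtain ⟨R, hR0, hR⟩ := (hbdd.subset hOK).subset_ball_lt 0 a
  refine not_near_id_on_sphere hG hG0 hR0 (a := a) fun z hz => ?_
  have hzO : z ∉ O := fun h => by
    have h1 := hR h
    simp only [mem_sphere, mem_ball] at hz h1
    linarith
  simp [G, hzO, hR0]

/-- **Janiszewski's theorem**: if neither of two closed sets with connected intersection separates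
`a` from `b`, then neither does their union. -/
theorem mem_connectedComponentIn_union {A B O₁ O₂ : Set ℂ} (hA : IsClosed A) (hB : IsClosed B)
    (hAB : IsPreconnected (A ∩ B)) (hbdd : Bornology.IsBounded (A ∪ B)ᶜ)
    (hO₁ : IsPreconnected O₁) (hO₂ : IsPreconnected O₂) (h₁ : Disjoint O₁ A) (h₂ : Disjoint O₂ B)
    {a b : ℂ} (ha₁ : a ∈ O₁) (hb₁ : b ∈ O₁) (ha₂ : a ∈ O₂) (hb₂ : b ∈ O₂) :
    b ∈ connectedComponentIn (A ∪ B)ᶜ a := by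
  have haA : a ∉ A := disjoint_left.1 h₁ ha₁
  have hbA : b ∉ A := disjoint_left.1 h₁ hb₁
  have haB : a ∉ B := disjoint_left.1 h₂ ha₂
  have hbB : b ∉ B := disjoint_left.1 h₂ hb₂
  refine HasLogQuot.mem_connectedComponentIn (hA.union hB) hbdd (by simp [haA, haB])
    (by simp [hbA, hbB]) ?_
  exact HasLogQuot.union hA hB hAB hbA (hasLogQuot_of_isPreconnected hA hO₁ h₁ ha₁ hb₁)
    (hasLogQuot_of_isPreconnected hB hO₂ h₂ ha₂ hb₂)

/-! ### Embedded disks have interior points -/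

theorem countable_preimage_of_det_fderiv_ne_zero {P : ℂ → ℂ} (hP : Differentiable ℝ P) {c : ℂ}
    (h : ∀ z, P z = c → (fderiv ℝ P z).det ≠ 0) : (P ⁻¹' {c}).Countable := by
  refine (IsClosed.isLindelof (isClosed_singleton.preimage hP.continuous)).countable ?_
  rw [discreteTopology_subtype_iff]
  intro z hz
  have hz' : P z = c := hz
  have hanti : ∃ C, AntilipschitzWith C (fderiv ℝ P z) := by
    obtain ⟨C, -, hC⟩ := LinearMap.exists_antilipschitzWith ((fderiv ℝ P z) : ℂ →ₗ[ℝ] ℂ) (by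
      rw [← LinearMap.isUnit_iff_ker_eq_bot, LinearMap.isUnit_iff_isUnit_det]
      exact isUnit_iff_ne_zero.2 (h z hz'))
    exact ⟨C, hC⟩
  have := (hP z).hasFDerivAt.eventually_ne (c := c) hanti
  rw [inf_principal_eq_bot]
  filter_upwards [this] with w hw using hw

/-- A continuous function on the plane can be approximated by one that does not vanish on a given
compact set with empty interior. -/
theorem exists_continuous_near_ne_zero {K : Set ℂ} (hK : IsCompact K) (hint : interior K = ∅)
    {E : ℂ → ℂ} (hE : Continuous E) {ε : ℝ} (hε : 0 < ε) :
    ∃ H : ℂ → ℂ, Continuous H ∧ ∀ z ∈ K, H z ≠ 0 ∧ ‖H z - E z‖ < ε := by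
  obtain ⟨P, hP, hPE, -⟩ := hE.exists_contDiff_approx 1 (continuous_const (y := ε / 4))
    (fun _ => by positivity)
  have hPd : Differentiable ℝ P := hP.differentiable (by simp)
  obtain ⟨c, hcε, hc⟩ : ∃ c : ℂ, ‖c‖ < ε / 4 ∧ ∀ z, P z = c → (fderiv ℝ P z).det ≠ 0 := by
    have hnull := MeasureTheory.addHaar_image_eq_zero_of_det_fderivWithin_eq_zero
      (MeasureTheory.volume : MeasureTheory.Measure ℂ) (s := {z | (fderiv ℝ P z).det = 0})
      (f := P) (f' := fderiv ℝ P) (fun z _ => (hPd z).hasFDerivAt.hasFDerivWithinAt)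
      (fun z hz => hz)
    have hnot : ¬ ball (0 : ℂ) (ε / 4) ⊆ P '' {z | (fderiv ℝ P z).det = 0} := fun hsub =>
      (measure_ball_pos MeasureTheory.volume (0 : ℂ) (by positivity : 0 < ε / 4)).ne'
        (MeasureTheory.measure_mono_null hsub hnull)
    obtain ⟨c, hc, hc'⟩ := not_subset.1 hnot
    exact ⟨c, by simpa using hc, fun z hz h0 => hc' ⟨z, h0, hz⟩⟩
  have hcount := countable_preimage_of_det_fderiv_ne_zero hPd hc
  have hunif : ∃ δ > 0, ∀ v : ℂ, ‖v‖ < δ → ∀ z ∈ K, ‖P (z + v) - P z‖ < ε / 4 := by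
    have hKc : IsCompact (cthickening 1 K) := hK.cthickening
    have := hKc.uniformContinuousOn_of_continuous hPd.continuous.continuousOn
    obtain ⟨δ, hδ, h⟩ := Metric.uniformContinuousOn_iff.1 this (ε / 4) (by positivity)
    refine ⟨min δ 1, by positivity, fun v hv z hz => ?_⟩
    have := h (z + v) (mem_cthickening_of_dist_le _ z _ _ hz (by
      simpa using (hv.trans_le (min_le_right _ _)).le)) z (self_subset_cthickening K hz)
      (by simpa using hv.trans_le (min_le_left _ _))
    simpa [dist_eq_norm] using this
  obtain ⟨δ, hδ, hδP⟩ := hunif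
  obtain ⟨v, hv, hvK⟩ : ∃ v : ℂ, ‖v‖ < δ ∧ ∀ z ∈ K, P (z + v) ≠ c := by
    have hdense : Dense (⋂ ζ ∈ P ⁻¹' {c}, ((fun v => ζ - v) ⁻¹' K)ᶜ) := by
      refine dense_biInter_of_isOpen (fun ζ _ => ?_) hcount (fun ζ _ => ?_)
      · exact (hK.isClosed.preimage (by fun_prop)).isOpen_compl
      · have : ((fun v => ζ - v) ⁻¹' K)ᶜ = (Homeomorph.subLeft ζ) ⁻¹' Kᶜ := rfl
        rw [this, ← (Homeomorph.subLeft ζ).image_symm]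
        exact (Homeomorph.subLeft ζ).symm.surjective.denseRange.dense_image
          (Homeomorph.subLeft ζ).symm.continuous (interior_eq_empty_iff_dense_compl.1 hint)
    obtain ⟨v, hv, hv'⟩ := hdense.exists_mem_open isOpen_ball ⟨0, mem_ball_self hδ⟩
    refine ⟨v, by simpa using hv', fun z hz hzc => ?_⟩
    simp only [mem_iInter] at hv
    exact hv (z + v) hzc (by simpa using hz)
  refine ⟨fun z => P (z + v) - c, by have := hPd.continuous; fun_prop, fun z hz =>
    ⟨sub_ne_zero.2 (hvK z hz), ?_⟩⟩
  have h1 := hδP v hv z hz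
  have h2 : ‖P z - E z‖ < ε / 4 := by simpa [dist_eq_norm] using hPE z
  have : P (z + v) - c - E z = (P (z + v) - P z) + (P z - E z) - c := by ring
  rw [this]
  have h3 := norm_sub_le ((P (z + v) - P z) + (P z - E z)) c
  have h4 := norm_add_le (P (z + v) - P z) (P z - E z)
  linarith

/-- An injective continuous image of a closed disk in the plane has nonempty interior. -/
theorem interior_image_closedBall_nonempty {φ : ℂ → ℂ} {c : ℂ} {r : ℝ} (hr : 0 < r)
    (hφ : ContinuousOn φ (closedBall c r)) (hinj : InjOn φ (closedBall c r)) :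
    (interior (φ '' closedBall c r)).Nonempty := by
  by_contra hempty
  rw [not_nonempty_iff_eq_empty] at hempty
  set D := closedBall c r with hD
  have hDc : IsCompact D := isCompact_closedBall c r
  set K := φ '' D with hKdef
  have hK : IsCompact K := hDc.image_of_continuousOn hφ
  have hemb : IsClosedEmbedding (D.domRestrict φ) := by
    have : CompactSpace D := isCompact_iff_compactSpace.1 hDc
    exact (continuousOn_iff_continuous_domRestrict.1 hφ).isClosedEmbedding
      (injOn_iff_injective.1 hinj)
  obtain ⟨E, hE⟩ := ContinuousMap.exists_extension (Y := ℂ) hemb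
    ⟨fun x : D => (x : ℂ) - c, by fun_prop⟩
  have hE' : ∀ x ∈ D, E (φ x) = x - c := fun x hx => by
    have := congrArg (fun f => f ⟨x, hx⟩) hE
    simpa using this
  obtain ⟨H, hH, hHK⟩ := exists_continuous_near_ne_zero hK hempty E.continuous hr
  let ρ : ℂ → ℂ := fun z => c + ((r / max r ‖z - c‖ : ℝ) : ℂ) * (z - c)
  have hmax : ∀ z, 0 < max r ‖z - c‖ := fun z => lt_max_of_lt_left hr
  have hρ : Continuous ρ := by
    have : Continuous fun z : ℂ => r / max r ‖z - c‖ :=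
      continuous_const.div (by fun_prop) fun z => (hmax z).ne'
    fun_prop
  have hρD : ∀ z, ρ z ∈ D := by
    intro z
    simp only [ρ, hD, mem_closedBall, dist_eq_norm, add_sub_cancel_left, norm_mul,
      Complex.norm_real, Real.norm_eq_abs, abs_of_nonneg (div_nonneg hr.le (hmax z).le)]
    rw [div_mul_eq_mul_div, div_le_iff₀ (hmax z)]
    exact mul_le_mul_of_nonneg_left (le_max_right _ _) hr.le
  have hρid : ∀ z ∈ sphere c r, ρ z = z := by
    intro z hz
    have : ‖z - c‖ = r := by simpa [dist_eq_norm] using hz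
    simp [ρ, this, hr.ne']
  have hcont : Continuous fun z => H (φ (ρ z)) :=
    hH.comp (hφ.comp_continuous hρ hρD)
  refine not_near_id_on_sphere hcont (fun z => (hHK _ ⟨_, hρD z, rfl⟩).1) hr (a := c)
    fun z hz => ?_
  have hzD := hρD z
  rw [hρid z hz] at hzD ⊢
  rw [← hE' z hzD]
  exact (hHK _ ⟨z, hzD, rfl⟩).2

/-! ### The Cauchy–Pompeiu formula -/

/-- Twice the Wirtinger derivative `∂u/∂z̄`. -/
noncomputable def dbar (u : ℂ → ℂ) (w : ℂ) : ℂ :=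
  fderiv ℝ u w 1 + Complex.I * fderiv ℝ u w Complex.I

theorem continuous_dbar {u : ℂ → ℂ} (hu : ContDiff ℝ 1 u) : Continuous (dbar u) := by
  have := hu.continuous_fderiv one_ne_zero
  unfold dbar
  fun_prop

/-- **Cauchy–Pompeiu formula** for compactly supported functions. -/
theorem integral_dbar_div_sub {u : ℂ → ℂ} (hu : ContDiff ℝ 1 u) (hs : HasCompactSupport u) (z : ℂ) :
    ∫ w, dbar u w / (w - z) = -(2 * Real.pi) * u z := by
  let e : ℝ → ℂ := fun θ => (Real.cos θ : ℂ) + (Real.sin θ : ℂ) * Complex.I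
  have he : Continuous e := by fun_prop
  have hne : ∀ θ, ‖e θ‖ = 1 := by
    intro θ
    have : e θ = Complex.exp (θ * Complex.I) := by simp [e, Complex.exp_mul_I]
    rw [this, Complex.norm_exp_ofReal_mul_I]
  have he' : ∀ θ, HasDerivAt e (Complex.I * e θ) θ := by
    intro θ
    have h1 := (Real.hasDerivAt_cos θ).ofReal_comp
    have h2 := (Real.hasDerivAt_sin θ).ofReal_comp
    refine (h1.add (h2.mul_const Complex.I)).congr_deriv ?_
    simp only [e]
    push_cast
    linear_combination -Complex.sin θ * Complex.I_sq
  let γ : ℝ × ℝ → ℂ := fun p => z + p.1 * e p.2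
  have hγ : Continuous γ := by fun_prop
  have hDc := hu.continuous_fderiv one_ne_zero
  let A : ℝ × ℝ → ℂ := fun p => fderiv ℝ u (γ p) (e p.2)
  let B : ℝ × ℝ → ℂ := fun p => fderiv ℝ u (γ p) (Complex.I * e p.2)
  have hA : Continuous A := (hDc.comp hγ).clm_apply (by fun_prop)
  have hB : Continuous B := (hDc.comp hγ).clm_apply (by fun_prop)
  have hud : Differentiable ℝ u := hu.differentiable one_ne_zero
  obtain ⟨R, hR0, hR⟩ : ∃ R > 0, ∀ w, R < ‖w - z‖ → fderiv ℝ u w = 0 ∧ u w = 0 := by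
    obtain ⟨R, hR0, hR⟩ := hs.isCompact.isBounded.subset_ball_lt 0 z
    refine ⟨R, hR0, fun w hw => ?_⟩
    have hwt : w ∉ tsupport u := fun h => by
      have := hR h
      rw [mem_ball, dist_eq_norm] at this
      linarith
    exact ⟨by
      by_contra h
      exact hwt (support_fderiv_subset ℝ h), image_eq_zero_of_notMem_tsupport hwt⟩
  have hfar : ∀ p : ℝ × ℝ, R < p.1 → fderiv ℝ u (γ p) = 0 ∧ u (γ p) = 0 := by
    intro p hp
    refine hR _ ?_
    have : γ p - z = p.1 * e p.2 := by simp [γ]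
    rw [this, norm_mul, hne, mul_one, Complex.norm_real, Real.norm_eq_abs]
    exact hp.trans_le (le_abs_self _)
  have hint : ∀ F : ℝ × ℝ → ℂ, Continuous F → (∀ p : ℝ × ℝ, R < p.1 → F p = 0) →
      IntegrableOn F (Ioi (0 : ℝ) ×ˢ Ioo (-Real.pi) Real.pi) := by
    intro F hF h0
    have h1 : IntegrableOn F (Icc (0 : ℝ) R ×ˢ Icc (-Real.pi) Real.pi) :=
      hF.continuousOn.integrableOn_compact (isCompact_Icc.prod isCompact_Icc)
    refine h1.of_forall_sdiff_eq_zero (measurableSet_Ioi.prod measurableSet_Ioo) ?_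
    rintro p ⟨⟨hp1, hp2⟩, hp3⟩
    refine h0 p ?_
    by_contra h
    exact hp3 ⟨⟨le_of_lt hp1, not_lt.1 h⟩, ⟨hp2.1.le, hp2.2.le⟩⟩
  have hAint := hint A hA fun p hp => by simp [A, (hfar p hp).1]
  have hBint := hint B hB fun p hp => by simp [B, (hfar p hp).1]
  have hAB : ∀ p ∈ polarCoord.target,
      p.1 • (dbar u (z + Complex.polarCoord.symm p) / (Complex.polarCoord.symm p)) =
        A p + Complex.I * B p := by
    rintro ⟨r, θ⟩ hp
    have hr : 0 < r := hp.1
    have hr' : (r : ℂ) ≠ 0 := by exact_mod_cast hr.ne'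
    have h0 : e θ ≠ 0 := by
      intro h; have := hne θ; simp [h] at this
    have hsymm : Complex.polarCoord.symm (r, θ) = r * e θ := by simp [e]
    have hA' : A (r, θ) = Real.cos θ * fderiv ℝ u (γ (r, θ)) 1 +
        Real.sin θ * fderiv ℝ u (γ (r, θ)) Complex.I := by
      have : e θ = Real.cos θ • (1 : ℂ) + Real.sin θ • Complex.I := by simp [e]
      simp only [A]
      rw [this, map_add, map_smul, map_smul, Complex.real_smul, Complex.real_smul]
    have hB' : B (r, θ) = -Real.sin θ * fderiv ℝ u (γ (r, θ)) 1 +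
        Real.cos θ * fderiv ℝ u (γ (r, θ)) Complex.I := by
      have : Complex.I * e θ = (-Real.sin θ) • (1 : ℂ) + Real.cos θ • Complex.I := by
        simp only [e, Complex.real_smul]
        push_cast
        linear_combination Complex.sin θ * Complex.I_sq
      simp only [B]
      rw [this, map_add, map_smul, map_smul, Complex.real_smul, Complex.real_smul]
      push_cast; ring
    rw [hsymm, hA', hB', Complex.real_smul, mul_comm (r : ℂ) (e θ), ← div_div,
      mul_div_cancel₀ _ hr', div_eq_iff h0]
    have hcs : (Real.cos θ : ℂ) ^ 2 + (Real.sin θ : ℂ) ^ 2 = 1 := by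
      exact_mod_cast Real.cos_sq_add_sin_sq θ
    have hγ' : z + e θ * r = γ (r, θ) := by simp [γ, mul_comm]
    rw [hγ']
    simp only [dbar, e]
    generalize fderiv ℝ u (γ (r, θ)) 1 = x
    generalize fderiv ℝ u (γ (r, θ)) Complex.I = y
    linear_combination -(x + Complex.I * y) * hcs +
      (x * Real.sin θ ^ 2 - y * Real.sin θ * Real.cos θ) * Complex.I_sq
  have hAval : ∫ p in polarCoord.target, A p = -(2 * Real.pi) * u z := by
    have hswap : ∫ p in polarCoord.target, A p =
        ∫ θ in Ioo (-Real.pi) Real.pi, ∫ r in Ioi (0 : ℝ), A (r, θ) := by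
      rw [polarCoord_target, Measure.volume_eq_prod, ← setIntegral_prod_swap]
      exact setIntegral_prod _ (by
        have := hAint
        rw [Measure.volume_eq_prod] at this
        exact this.swap)
    have hr : ∀ θ, ∫ r in Ioi (0 : ℝ), A (r, θ) = -u z := by
      intro θ
      have hd : ∀ r ∈ Ici (0 : ℝ), HasDerivAt (fun r : ℝ => u (γ (r, θ))) (A (r, θ)) r := by
        intro r _
        have h1 : HasDerivAt (fun r : ℝ => γ (r, θ)) (e θ) r := by
          simpa [γ] using ((hasDerivAt_id r).ofReal_comp.mul_const (e θ)).const_add z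
        exact (hud _).hasFDerivAt.comp_hasDerivAt r h1
      have hi : IntegrableOn (fun r : ℝ => A (r, θ)) (Ioi 0) := by
        have h1 : IntegrableOn (fun r : ℝ => A (r, θ)) (Icc 0 R) :=
          (hA.comp (by fun_prop : Continuous fun r : ℝ => (r, θ))).continuousOn.integrableOn_Icc
        refine h1.of_forall_sdiff_eq_zero measurableSet_Ioi ?_
        rintro r ⟨hr1, hr2⟩
        have : R < r := by
          by_contra h
          exact hr2 ⟨le_of_lt hr1, not_lt.1 h⟩
        simp [A, (hfar (r, θ) this).1]
      have ht : Tendsto (fun r : ℝ => u (γ (r, θ))) atTop (𝓝 0) := by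
        refine tendsto_const_nhds.congr' ?_
        filter_upwards [eventually_gt_atTop R] with r hr
        exact ((hfar (r, θ) hr).2).symm
      rw [integral_Ioi_of_hasDerivAt_of_tendsto' hd hi ht]
      simp [γ]
    rw [hswap]
    simp only [hr]
    rw [setIntegral_const]
    rw [Real.volume_real_Ioo_of_le (by linarith [Real.pi_pos]), Complex.real_smul]
    push_cast
    ring
  have hBval : ∫ p in polarCoord.target, B p = 0 := by
    rw [polarCoord_target, Measure.volume_eq_prod, setIntegral_prod _ (by
      rw [← Measure.volume_eq_prod]; exact hBint)]
    refine setIntegral_eq_zero_of_forall_eq_zero fun r hr => ?_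
    have hr0 : (r : ℝ) ≠ 0 := ne_of_gt hr
    rw [← integral_Ioc_eq_integral_Ioo, ← intervalIntegral.integral_of_le (by
      linarith [Real.pi_pos])]
    have hd : ∀ θ ∈ uIcc (-Real.pi) Real.pi,
        HasDerivAt (fun θ : ℝ => r⁻¹ • u (γ (r, θ))) (B (r, θ)) θ := by
      intro θ _
      have h1 : HasDerivAt (fun θ : ℝ => γ (r, θ)) (r * (Complex.I * e θ)) θ :=
        ((he' θ).const_mul (r : ℂ)).const_add z
      have h2 := ((hud (γ (r, θ))).hasFDerivAt.comp_hasDerivAt θ h1).const_smul r⁻¹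
      refine h2.congr_deriv ?_
      rw [← Complex.real_smul, map_smul, smul_smul, inv_mul_cancel₀ hr0, one_smul]
    rw [intervalIntegral.integral_eq_sub_of_hasDerivAt hd
      ((hB.comp (by fun_prop : Continuous fun θ : ℝ => (r, θ))).intervalIntegrable _ _)]
    simp [γ, e]
  calc ∫ w, dbar u w / (w - z) = ∫ w, dbar u (z + w) / w := by
        rw [← integral_add_left_eq_self _ z]
        simp
    _ = ∫ p in polarCoord.target, (A p + Complex.I * B p) := by
        rw [← Complex.integral_comp_polarCoord_symm]
        exact setIntegral_congr_fun polarCoord.open_target.measurableSet hAB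
    _ = -(2 * Real.pi) * u z := by
        rw [integral_add (by exact hAint) (by exact hBint.const_mul _), integral_const_mul, hAval,
          hBval]
        simp

/-! ### Primitives and logarithms on domains with connected complement -/

theorem hasDerivAt_of_exp_eq_sub {ℓ : ℂ → ℂ} {O : Set ℂ} {w : ℂ} (hO : IsOpen O)
    (hℓ : ContinuousOn ℓ O) (hexp : ∀ z ∈ O, Complex.exp (ℓ z) = z - w) {z : ℂ} (hz : z ∈ O) :
    HasDerivAt ℓ (1 / (z - w)) z := by
  have h1 : HasDerivAt (fun x => Complex.exp x + w) (Complex.exp (ℓ z)) (ℓ z) :=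
    (Complex.hasDerivAt_exp _).add_const w
  have := HasDerivAt.of_local_left_inverse (hℓ.continuousAt (hO.mem_nhds hz)) h1
    (Complex.exp_ne_zero _) (by
      filter_upwards [hO.mem_nhds hz] with y hy
      rw [hexp y hy]; ring)
  rwa [hexp z hz, ← one_div] at this

theorem exists_primitive_setIntegral_of_subset {μ : ℂ → ℂ} (hμ : Continuous μ) {O T : Set ℂ}
    (hO : IsOpen O) {w₀ : ℂ} {r : ℝ} (hr : 0 < r) (hT : T ⊆ closedBall w₀ r)
    (hd : ∀ z ∈ O, 2 * r ≤ ‖z - w₀‖) {ℓ : ℂ → ℂ}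
    (hℓ : ∀ z ∈ O, HasDerivAt ℓ (1 / (z - w₀)) z) :
    ∃ H : ℂ → ℂ, ∀ z ∈ O, HasDerivAt H (∫ w in T, μ w / (z - w)) z := by
  have hq : ∀ z ∈ O, ∀ w ∈ closedBall w₀ r, ‖(w - w₀) / (z - w₀)‖ < 1 := by
    intro z hz w hw
    rw [mem_closedBall, dist_eq_norm] at hw
    have := hd z hz
    rw [norm_div, div_lt_one (by linarith)]
    linarith
  have hslit : ∀ z ∈ O, ∀ w ∈ closedBall w₀ r, 1 - (w - w₀) / (z - w₀) ∈ Complex.slitPlane := by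
    intro z hz w hw
    rw [sub_eq_add_neg]
    exact Complex.mem_slitPlane_of_norm_lt_one (by rw [norm_neg]; exact hq z hz w hw)
  have hfar : ∀ z ∈ O, ∀ w ∈ closedBall w₀ r, r ≤ ‖z - w‖ := by
    intro z hz w hw
    rw [mem_closedBall, dist_eq_norm] at hw
    have h1 := hd z hz
    have h2 : ‖z - w₀‖ ≤ ‖z - w‖ + ‖w - w₀‖ := by
      simpa using norm_add_le (z - w) (w - w₀)
    linarith
  have hcont : ∀ z ∈ O, ContinuousOn
      (fun w => μ w * (ℓ z + Complex.log (1 - (w - w₀) / (z - w₀)))) (closedBall w₀ r) := by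
    intro z hz
    refine hμ.continuousOn.mul (continuousOn_const.add (ContinuousOn.clog ?_ (hslit z hz)))
    fun_prop
  have hcont' : ∀ z ∈ O, ContinuousOn (fun w => μ w / (z - w)) (closedBall w₀ r) := by
    intro z hz
    refine hμ.continuousOn.div (by fun_prop) fun w hw h => ?_
    have := hfar z hz w hw
    rw [h, norm_zero] at this
    linarith
  have hcomp : IsCompact (closedBall w₀ r) := isCompact_closedBall _ _
  refine ⟨fun z => ∫ w in T, μ w * (ℓ z + Complex.log (1 - (w - w₀) / (z - w₀))), fun z hz => ?_⟩
  refine (hasDerivAt_integral_of_dominated_loc_of_deriv_le (𝕜 := ℂ) (μ := volume.restrict T)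
    (F := fun z w => μ w * (ℓ z + Complex.log (1 - (w - w₀) / (z - w₀))))
    (F' := fun z w => μ w / (z - w)) (bound := fun w => ‖μ w‖ / r)
    (hO.mem_nhds hz) ?_ ?_ ?_ ?_ ?_ ?_).2
  · filter_upwards [hO.mem_nhds hz] with y hy
    exact ((hcont y hy).aestronglyMeasurable hcomp.measurableSet).mono_set hT
  · exact ((hcont z hz).integrableOn_compact hcomp).mono_set hT
  · exact ((hcont' z hz).aestronglyMeasurable hcomp.measurableSet).mono_set hT
  · refine ae_restrict_of_ae_restrict_of_subset hT
      (ae_restrict_of_forall_mem hcomp.measurableSet ?_)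
    intro w hw y hy
    rw [norm_div]
    exact div_le_div_of_nonneg_left (norm_nonneg _) hr (hfar y hy w hw)
  · exact ((hμ.norm.div_const r).continuousOn.integrableOn_compact hcomp).mono_set hT
  · refine ae_restrict_of_ae_restrict_of_subset hT
      (ae_restrict_of_forall_mem hcomp.measurableSet ?_)
    intro w hw y hy
    have hy0 : y - w₀ ≠ 0 := fun h => by
      have := hd y hy
      rw [h, norm_zero] at this
      linarith
    have hyw : y - w ≠ 0 := fun h => by
      have := hfar y hy w hw
      rw [h, norm_zero] at this
      linarith
    have h1 : HasDerivAt (fun x : ℂ => 1 - (w - w₀) / (x - w₀)) ((w - w₀) / (y - w₀) ^ 2) y := by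
      have := ((hasDerivAt_const y (w - w₀)).div ((hasDerivAt_id y).sub_const w₀) hy0).const_sub 1
      refine this.congr_deriv ?_
      simp
      ring
    have h2 := (((hℓ y hy).add (h1.clog (hslit y hy w hw))).const_mul (μ w))
    refine h2.congr_deriv ?_
    have h3 : 1 - (w - w₀) / (y - w₀) = (y - w) / (y - w₀) := by field_simp; ring
    rw [h3]
    field_simp
    ring

theorem exists_primitive_setIntegral {μ : ℂ → ℂ} (hμ : Continuous μ) {O S : Set ℂ}
    (hO : IsOpen O) (hS : IsCompact S)
    (hd : ∀ w ∈ S, ∃ r > 0, ∀ z ∈ O, 2 * r ≤ ‖z - w‖)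
    (hlog : ∀ w ∈ S, ∃ ℓ : ℂ → ℂ, ∀ z ∈ O, HasDerivAt ℓ (1 / (z - w)) z) :
    ∃ H : ℂ → ℂ, ∀ z ∈ O, HasDerivAt H (∫ w in S, μ w / (z - w)) z := by
  let P : Set ℂ → Prop := fun T => ∃ T₁, T ⊆ T₁ ∧ MeasurableSet T₁ ∧ ∀ T' ⊆ T₁, MeasurableSet T' →
    T' ⊆ S → ∃ H : ℂ → ℂ, ∀ z ∈ O, HasDerivAt H (∫ w in T', μ w / (z - w)) z
  have hint : ∀ z ∈ O, IntegrableOn (fun w => μ w / (z - w)) S := by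
    intro z hz
    refine (hμ.continuousOn.div (by fun_prop) fun w hw h => ?_).integrableOn_compact hS
    obtain ⟨r, hr, h'⟩ := hd w hw
    have := h' z hz
    rw [h, norm_zero] at this
    linarith
  have key : P S := by
    refine hS.induction_on (p := P) ?_ ?_ ?_ ?_
    · refine ⟨∅, subset_rfl, MeasurableSet.empty, fun T' hT' _ _ => ⟨0, fun z _ => ?_⟩⟩
      rw [subset_empty_iff.1 hT']
      simp [hasDerivAt_zero]
    · rintro s t hst ⟨T, hT, h⟩
      exact ⟨T, hst.trans hT, h⟩
    · rintro s t ⟨T, hsT, hTm, hT⟩ ⟨T₂, htT, hTm₂, hT₂⟩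
      refine ⟨T ∪ T₂, union_subset_union hsT htT, hTm.union hTm₂, fun T' hT' hm hS' => ?_⟩
      obtain ⟨H, hH⟩ := hT (T' ∩ T) inter_subset_right (hm.inter hTm)
        (inter_subset_left.trans hS')
      obtain ⟨H₂, hH₂⟩ := hT₂ (T' \ T) (fun x hx => (hT' hx.1).resolve_left hx.2) (hm.diff hTm)
        (sdiff_subset.trans hS')
      refine ⟨fun z => H z + H₂ z, fun z hz => ?_⟩
      rw [← integral_inter_add_sdiff hTm ((hint z hz).mono_set hS')]
      exact (hH z hz).add (hH₂ z hz)
    · intro w hw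
      obtain ⟨r, hr, h'⟩ := hd w hw
      obtain ⟨ℓ, hℓ⟩ := hlog w hw
      refine ⟨closedBall w r, mem_nhdsWithin_of_mem_nhds (closedBall_mem_nhds w hr),
        closedBall w r, subset_rfl, isClosed_closedBall.measurableSet, fun T' hT' hm hS' => ?_⟩
      exact exists_primitive_setIntegral_of_subset hμ hO hr hT' h' hℓ
  obtain ⟨T, hST, -, hT⟩ := key
  exact hT S hST hS.measurableSet subset_rfl

theorem isPreconnected_setOf_infDist_lt {T : Set ℂ} (hT : IsPreconnected T) (hne : T.Nonempty)
    {ρ : ℝ} (hρ : 0 < ρ) : IsPreconnected {z | infDist z T < ρ} := by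
  obtain ⟨p, hp⟩ := hne
  have hsub : T ⊆ {z | infDist z T < ρ} := fun x hx => by
    rw [mem_ofPred_eq, infDist_zero_of_mem hx]; exact hρ
  refine isPreconnected_of_forall p fun y hy => ?_
  obtain ⟨x, hx, hxy⟩ := (infDist_lt_iff ⟨p, hp⟩).1 hy
  refine ⟨T ∪ ball x ρ, union_subset hsub fun z hz => ?_, Or.inl hp,
    Or.inr (by rwa [mem_ball]), ?_⟩
  · exact (infDist_le_dist_of_mem hx).trans_lt hz
  · exact hT.union x hx (mem_ball_self hρ) (convex_ball x ρ).isPreconnected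

theorem dbar_eq_zero_of_differentiableAt {h : ℂ → ℂ} {z : ℂ} (hh : DifferentiableAt ℂ h z) :
    dbar h z = 0 := by
  have h1 := (hh.hasDerivAt.hasFDerivAt.restrictScalars ℝ).fderiv
  unfold dbar
  rw [h1]
  simp only [ContinuousLinearMap.coe_restrictScalars', ContinuousLinearMap.toSpanSingleton_apply,
    smul_eq_mul]
  linear_combination deriv h z * Complex.I_sq

theorem exists_primitive_of_isPreconnected_compl {W : Set ℂ} (hW : IsOpen W)
    (hb : Bornology.IsBounded W) (hc : IsPreconnected Wᶜ) {h : ℂ → ℂ} (hh : DifferentiableOn ℂ h W)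
    {ρ : ℝ} (hρ : 0 < ρ) :
    ∃ H : ℂ → ℂ, ∀ z, ρ < infDist z Wᶜ → HasDerivAt H (h z) z := by
  have hne : (Wᶜ).Nonempty := by
    by_contra hemp
    rw [not_nonempty_iff_eq_empty, compl_empty_iff] at hemp
    rw [hemp] at hb
    exact NoncompactSpace.noncompact_univ (isCompact_of_isClosed_isBounded isClosed_univ hb)
  have hKW : ∀ σ > 0, {z | σ ≤ infDist z Wᶜ} ⊆ W := by
    intro σ hσ z hz
    by_contra hzW
    rw [mem_ofPred_eq, infDist_zero_of_mem (show z ∈ Wᶜ from hzW)] at hz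
    linarith
  have hKcl : ∀ σ : ℝ, IsClosed {z | σ ≤ infDist z Wᶜ} := fun σ =>
    isClosed_le continuous_const (continuous_infDist_pt _)
  have hKc : ∀ σ > 0, IsCompact {z | σ ≤ infDist z Wᶜ} := fun σ hσ =>
    isCompact_of_isClosed_isBounded (hKcl σ) (hb.subset (hKW σ hσ))
  set K : Set ℂ := {z | ρ ≤ infDist z Wᶜ} with hKdef
  set t : Set ℂ := {z | ρ / 2 ≤ infDist z Wᶜ} with htdef
  set O : Set ℂ := {z | ρ < infDist z Wᶜ} with hOdef
  have hOopen : IsOpen O := isOpen_lt continuous_const (continuous_infDist_pt _)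
  have hOK : O ⊆ K := fun z (hz : ρ < infDist z Wᶜ) => hz.le
  have hKt : K ⊆ interior t := by
    have h1 : IsOpen {z : ℂ | ρ / 2 < infDist z Wᶜ} :=
      isOpen_lt continuous_const (continuous_infDist_pt _)
    refine fun z (hz : ρ ≤ infDist z Wᶜ) =>
      interior_maximal (fun y (hy : ρ / 2 < infDist y Wᶜ) => hy.le) h1 ?_
    exact (by linarith : ρ / 2 < infDist z Wᶜ)
  obtain ⟨χ, hχ1, hχ0, -⟩ := exists_contMDiffMap_one_nhds_of_subset_interior (n := 1)
    (modelWithCornersSelf ℝ ℂ) (hKcl ρ) hKt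
  have hχs : ContDiff ℝ 1 (fun z => (χ z : ℂ)) :=
    Complex.ofRealCLM.contDiff.comp χ.contMDiff.contDiff
  let u : ℂ → ℂ := fun z => χ z * h z
  have htW : t ⊆ W := hKW _ (by linarith)
  have hsupp : tsupport u ⊆ t := closure_minimal (fun z hz => by
    by_contra hzt
    exact hz (by simp [u, hχ0 z hzt])) (hKcl _)
  have hucs : HasCompactSupport u := (hKc _ (by linarith)).of_isClosed_subset
    (isClosed_tsupport u) hsupp
  have hu : ContDiff ℝ 1 u := by
    refine contDiff_iff_contDiffAt.2 fun z => ?_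
    by_cases hz : z ∈ W
    · exact hχs.contDiffAt.mul
        (((hh.analyticAt (hW.mem_nhds hz)).contDiffAt (n := 1)).restrict_scalars ℝ)
    · have hzt : z ∉ tsupport u := fun h' => hz (htW (hsupp h'))
      exact contDiffAt_const.congr_of_eventuallyEq (notMem_tsupport_iff_eventuallyEq.1 hzt)
  have hμ : Continuous (dbar u) := continuous_dbar hu
  set S := tsupport (dbar u) with hS
  have hdsub : S ⊆ tsupport u := by
    refine closure_minimal (fun z hz => ?_) (isClosed_tsupport u)
    by_contra hzt
    refine hz ?_
    have : fderiv ℝ u z = 0 := by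
      by_contra h'
      exact hzt (support_fderiv_subset ℝ h')
    simp [dbar, this]
  have hSc : IsCompact S := hucs.isCompact.of_isClosed_subset (isClosed_tsupport _) hdsub
  have hSK : Disjoint S K := by
    rw [disjoint_right]
    intro z hz
    rw [notMem_tsupport_iff_eventuallyEq]
    have h1 : ∀ᶠ x in 𝓝 z, χ x = 1 := hχ1.filter_mono (nhds_le_nhdsSet hz)
    filter_upwards [h1.eventually_nhds, hW.mem_nhds (hKW ρ hρ hz)] with y hy hyW
    have h2 : u =ᶠ[𝓝 y] h := by
      filter_upwards [hy] with x hx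
      simp [u, hx]
    have h3 : dbar u y = dbar h y := by simp only [dbar, h2.fderiv_eq]
    rw [h3]
    exact dbar_eq_zero_of_differentiableAt (hh.differentiableAt (hW.mem_nhds hyW))
  have hd : ∀ w ∈ S, ∃ r > 0, ∀ z ∈ O, 2 * r ≤ ‖z - w‖ := by
    intro w hw
    obtain ⟨r, hr, hrK⟩ := Metric.isOpen_iff.1 (hKcl ρ).isOpen_compl w (disjoint_left.1 hSK hw)
    refine ⟨r / 2, by linarith, fun z hz => ?_⟩
    by_contra hlt
    refine hrK (a := z) ?_ (hOK hz)
    rw [mem_ball, dist_eq_norm]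
    linarith
  have hlog : ∀ w ∈ S, ∃ ℓ : ℂ → ℂ, ∀ z ∈ O, HasDerivAt ℓ (1 / (z - w)) z := by
    intro w hw
    obtain ⟨R, hR0, hR⟩ := hb.subset_ball_lt 0 0
    have hbW : (-(R : ℂ)) ∉ W := fun h' => by
      have := hR h'
      rw [mem_ball_zero_iff, norm_neg, Complex.norm_real, Real.norm_eq_abs, abs_of_pos hR0] at this
      exact lt_irrefl _ this
    have hKc' : Kᶜ = {z | infDist z Wᶜ < ρ} := by ext z; simp [hKdef]
    obtain ⟨L, hL, hLe⟩ := hasLogQuot_of_isPreconnected (hKcl ρ)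
      (hKc' ▸ isPreconnected_setOf_infDist_lt hc hne hρ) disjoint_compl_left
      (show w ∈ Kᶜ from disjoint_left.1 hSK hw)
      (show (-(R : ℂ)) ∈ Kᶜ from fun h' => hbW (hKW ρ hρ h'))
    have hslit : ∀ z ∈ O, z - (-(R : ℂ)) ∈ Complex.slitPlane := by
      intro z hz
      have h1 := hR (hKW ρ hρ (hOK hz))
      rw [mem_ball_zero_iff] at h1
      have h2 := (abs_le.1 (Complex.abs_re_le_norm z)).1
      refine Complex.mem_slitPlane_iff.2 (Or.inl ?_)
      simp
      linarith
    refine ⟨fun z => L z + Complex.log (z - (-(R : ℂ))), fun z hz =>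
      hasDerivAt_of_exp_eq_sub hOopen (ContinuousOn.add (hL.mono hOK)
        (ContinuousOn.clog (by fun_prop) hslit)) (fun y hy => ?_) hz⟩
    change Complex.exp (L y + Complex.log (y - (-(R : ℂ)))) = y - w
    rw [Complex.exp_add, Complex.exp_log (Complex.slitPlane_ne_zero (hslit y hy)), hLe y (hOK hy)]
  obtain ⟨H, hH⟩ := exists_primitive_setIntegral hμ hOopen hSc hd hlog
  refine ⟨fun z => H z * (1 / (2 * Real.pi)), fun z hz => ?_⟩
  refine ((hH z hz).mul_const _).congr_deriv ?_
  have h1 := integral_dbar_div_sub hu hucs z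
  have h2 : ∫ w in S, dbar u w / (z - w) = -∫ w, dbar u w / (w - z) := by
    rw [setIntegral_eq_integral_of_forall_compl_eq_zero, ← integral_neg]
    · congr 1
      ext w
      rw [← neg_sub w z, div_neg]
    · intro w hw
      rw [image_eq_zero_of_notMem_tsupport hw, zero_div]
  have h3 : u z = h z := by
    have : χ z = 1 := (hχ1.filter_mono (nhds_le_nhdsSet (hOK hz))).self_of_nhds
    simp [u, this]
  rw [h2, h1, h3]
  have hpi : (Real.pi : ℂ) ≠ 0 := by exact_mod_cast Real.pi_ne_zero
  field_simp

theorem exists_primitive_of_isPreconnected_compl' {W : Set ℂ} (hW : IsOpen W)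
    (hWc : IsPreconnected W) (hb : Bornology.IsBounded W) (hc : IsPreconnected Wᶜ) {h : ℂ → ℂ}
    (hh : DifferentiableOn ℂ h W) :
    ∃ H : ℂ → ℂ, ∀ z ∈ W, HasDerivAt H (h z) z := by
  rcases W.eq_empty_or_nonempty with rfl | ⟨z₀, hz₀⟩
  · exact ⟨0, by simp⟩
  have hne : (Wᶜ).Nonempty := by
    by_contra hemp
    rw [not_nonempty_iff_eq_empty, compl_empty_iff] at hemp
    rw [hemp] at hb
    exact NoncompactSpace.noncompact_univ (isCompact_of_isClosed_isBounded isClosed_univ hb)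
  let O : ℕ → Set ℂ := fun n => {z | 1 / ((n : ℝ) + 1) < infDist z Wᶜ}
  have hO : ∀ n, IsOpen (O n) := fun n => isOpen_lt continuous_const (continuous_infDist_pt _)
  have hOmono : ∀ n m, n ≤ m → O n ⊆ O m := by
    intro n m hnm z (hz : 1 / ((n : ℝ) + 1) < infDist z Wᶜ)
    exact (Nat.one_div_le_one_div hnm).trans_lt hz
  let C : ℕ → Set ℂ := fun n => connectedComponentIn (O n) z₀
  have hCo : ∀ n, IsOpen (C n) := fun n => (hO n).connectedComponentIn
  have hCmono : ∀ n m, n ≤ m → C n ⊆ C m := fun n m hnm =>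
    connectedComponentIn_mono z₀ (hOmono n m hnm)
  have hcover : ∀ z ∈ W, ∃ n, z ∈ C n := by
    intro z hz
    obtain ⟨γ, hγ⟩ := (hW.isConnected_iff_isPathConnected.1 ⟨⟨z₀, hz₀⟩, hWc⟩).joinedIn z₀ hz₀ z hz
    obtain ⟨w, ⟨t, rfl⟩, hmin⟩ := (isCompact_range γ.continuous).exists_isMinOn
      (range_nonempty γ) (continuous_infDist_pt Wᶜ).continuousOn
    have hpos : 0 < infDist (γ t) Wᶜ :=
      (hW.isClosed_compl.notMem_iff_infDist_pos hne).1 (fun h' => h' (hγ t))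
    obtain ⟨n, hn⟩ := exists_nat_one_div_lt hpos
    have hsub : range γ ⊆ O n := fun y hy => hn.trans_le (hmin hy)
    refine ⟨n, (isPreconnected_range γ.continuous).subset_connectedComponentIn ⟨0, γ.source⟩ hsub
      ⟨1, γ.target⟩⟩
  have hprim : ∀ n, ∃ H : ℂ → ℂ, ∀ z ∈ O n, HasDerivAt H (h z) z := fun n =>
    exists_primitive_of_isPreconnected_compl hW hb hc hh (by positivity)
  choose H hH using hprim
  have hCO : ∀ n, C n ⊆ O n := fun n => connectedComponentIn_subset _ _
  let G : ℕ → ℂ → ℂ := fun n z => H n z - H n z₀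
  have hG : ∀ n, ∀ z ∈ C n, HasDerivAt (G n) (h z) z := fun n z hz =>
    (hH n z (hCO n hz)).sub_const _
  have hagree : ∀ n m, n ≤ m → EqOn (G m) (G n) (C n) := by
    intro n m hnm z hz
    have hz₀n : z₀ ∈ C n := by
      refine mem_connectedComponentIn ?_
      by_contra h'
      simp only [C, connectedComponentIn_eq_empty h'] at hz
      exact hz
    refine (hCo n).eqOn_of_deriv_eq isPreconnected_connectedComponentIn
      (fun y hy => (hG m y (hCmono n m hnm hy)).differentiableAt.differentiableWithinAt)
      (fun y hy => (hG n y hy).differentiableAt.differentiableWithinAt)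
      (fun y hy => ?_) hz₀n (by simp [G]) hz
    rw [(hG m y (hCmono n m hnm hy)).deriv, (hG n y hy).deriv]
  choose! N hN using hcover
  refine ⟨fun z => G (N z) z, fun z hz => ?_⟩
  refine (hG (N z) z (hN z hz)).congr_of_eventuallyEq ?_
  filter_upwards [(hCo _).mem_nhds (hN z hz), hW.mem_nhds hz] with y hy hyW
  rcases le_total (N z) (N y) with hle | hle
  · exact hagree _ _ hle hy
  · exact (hagree _ _ hle (hN y hyW)).symm

/-- On a bounded domain with connected complement, nowhere vanishing holomorphic functions have
holomorphic logarithms. -/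
theorem exists_log_of_isPreconnected_compl {W : Set ℂ} (hW : IsOpen W)
    (hWc : IsPreconnected W) (hb : Bornology.IsBounded W) (hc : IsPreconnected Wᶜ) {g : ℂ → ℂ}
    (hg : DifferentiableOn ℂ g W) (h0 : ∀ z ∈ W, g z ≠ 0) :
    ∃ L : ℂ → ℂ, DifferentiableOn ℂ L W ∧ ∀ z ∈ W, Complex.exp (L z) = g z := by
  rcases W.eq_empty_or_nonempty with rfl | ⟨z₀, hz₀⟩
  · exact ⟨0, by simp⟩
  obtain ⟨H, hH⟩ := exists_primitive_of_isPreconnected_compl' hW hWc hb hc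
    ((hg.deriv hW).div hg h0)
  have hgd : ∀ z ∈ W, HasDerivAt g (deriv g z) z := fun z hz =>
    (hg.differentiableAt (hW.mem_nhds hz)).hasDerivAt
  have hd : ∀ z ∈ W, HasDerivAt (fun y => g y * Complex.exp (-H y)) 0 z := by
    intro z hz
    refine ((hgd z hz).mul (hH z hz).neg.cexp).congr_deriv ?_
    have := h0 z hz
    simp only [Pi.neg_apply, Pi.div_apply]
    field_simp
    ring
  refine ⟨fun z => H z + (Complex.log (g z₀) - H z₀), fun z hz =>
    ((hH z hz).add_const _).differentiableAt.differentiableWithinAt, fun z hz => ?_⟩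
  have h1 := hW.is_const_of_deriv_eq_zero hWc
    (fun y hy => (hd y hy).differentiableAt.differentiableWithinAt) (fun y hy => (hd y hy).deriv)
    hz hz₀
  simp only [Complex.exp_neg] at h1
  rw [Complex.exp_add, Complex.exp_sub, Complex.exp_log (h0 z₀ hz₀)]
  field_simp at h1 ⊢
  exact h1.symm

/-! ### The Riemann mapping theorem -/

/-- **Hurwitz's theorem**: a locally uniform limit of nowhere vanishing holomorphic functions has
no isolated zeros. -/
theorem eventually_eq_zero_of_tendstoLocallyUniformlyOn {ι : Type*} {φ : Filter ι} [φ.NeBot]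
    {F : ι → ℂ → ℂ} {g : ℂ → ℂ} {W : Set ℂ} (hW : IsOpen W)
    (hF : ∀ n, DifferentiableOn ℂ (F n) W) (h0 : ∀ n, ∀ z ∈ W, F n z ≠ 0)
    (hlim : TendstoLocallyUniformlyOn F g φ W) {b : ℂ} (hb : b ∈ W) (hgb : g b = 0) :
    ∀ᶠ z in 𝓝 b, g z = 0 := by
  have hg : DifferentiableOn ℂ g W := hlim.differentiableOn (Eventually.of_forall hF) hW
  rcases (hg.analyticAt (hW.mem_nhds hb)).eventually_eq_zero_or_eventually_ne_zero with h | h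
  · exact h
  exfalso
  rw [eventually_nhdsWithin_iff] at h
  obtain ⟨r, hr, hball⟩ := nhds_basis_closedBall.mem_iff.1 (h.and (hW.mem_nhds hb))
  have hrW : closedBall b r ⊆ W := fun z hz => (hball hz).2
  obtain ⟨w, hw, hmin⟩ :=
    (isCompact_sphere b r).exists_isMinOn (NormedSpace.sphere_nonempty.2 hr.le)
    ((hg.continuousOn.mono (sphere_subset_closedBall.trans hrW)).norm)
  have hm : 0 < ‖g w‖ := by
    rw [norm_pos_iff]
    refine (hball (sphere_subset_closedBall hw)).1 fun hwb => ?_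
    rw [mem_singleton_iff] at hwb
    rw [hwb, mem_sphere, dist_self] at hw
    exact hr.ne hw
  have hunif := (tendstoLocallyUniformlyOn_iff_forall_isCompact hW).1 hlim _ hrW
    (isCompact_closedBall b r)
  obtain ⟨n, hn⟩ := (Metric.tendstoUniformlyOn_iff.1 hunif (‖g w‖ / 2) (by linarith)).exists
  have hdc : DiffContOnCl ℂ (F n) (ball b r) :=
    ((hF n).mono (closure_ball_subset_closedBall.trans hrW)).diffContOnCl
  have hinv := hdc.inv fun z hz => h0 n z (hrW (closure_ball_subset_closedBall hz))
  have hle := Complex.norm_le_of_forall_mem_frontier_norm_le (C := (‖g w‖ / 2)⁻¹) isBounded_ball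
    hinv (fun z hz => by
      rw [frontier_ball _ hr.ne'] at hz
      rw [Pi.inv_apply, norm_inv]
      refine inv_anti₀ (by linarith) ?_
      have h1 := hn z (sphere_subset_closedBall hz)
      have h2 : ‖g w‖ ≤ ‖g z‖ := hmin hz
      rw [dist_eq_norm] at h1
      have h3 := norm_sub_norm_le (g z) (F n z)
      linarith) (subset_closure (mem_ball_self hr))
  have h1 := hn b (mem_closedBall_self hr.le)
  rw [hgb, dist_eq_norm, zero_sub, norm_neg] at h1
  have hb0 : 0 < ‖F n b‖ := norm_pos_iff.2 (h0 n b hb)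
  rw [Pi.inv_apply, norm_inv] at hle
  exact absurd ((inv_le_inv₀ hb0 (by linarith)).1 hle) (not_le.2 h1)

/-- A version of **Montel's theorem**: pointwise convergence of uniformly bounded holomorphic
functions is locally uniform. -/
theorem tendstoLocallyUniformlyOn_of_tendsto {ι : Type*} {φ : Filter ι}
    {F : ι → ℂ → ℂ} {f : ℂ → ℂ} {W : Set ℂ} (hW : IsOpen W)
    (hF : ∀ n, DifferentiableOn ℂ (F n) W) (hb : ∀ n, ∀ z ∈ W, ‖F n z‖ ≤ 1)
    (hlim : ∀ z ∈ W, Tendsto (fun n => F n z) φ (𝓝 (f z))) :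
    TendstoLocallyUniformlyOn F f φ W := by
  rcases φ.eq_or_neBot with rfl | hne
  · intro u hu x hx
    exact ⟨W, self_mem_nhdsWithin, by simp⟩
  rw [Metric.tendstoLocallyUniformlyOn_iff]
  intro ε hε x hx
  obtain ⟨r, hr, hrW⟩ := Metric.isOpen_iff.1 hW x hx
  have hlip : ∀ n, ∀ y ∈ ball x r, dist (F n y) (F n x) ≤ 2 / r * dist y x := by
    intro n y hy
    refine Complex.dist_le_div_mul_dist_of_mapsTo_ball ((hF n).mono hrW) (fun z hz => ?_) hy
    rw [mem_closedBall]
    refine (dist_le_norm_add_norm _ _).trans ?_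
    linarith [hb n z (hrW hz), hb n x hx]
  have hlipf : ∀ y ∈ ball x r, dist (f y) (f x) ≤ 2 / r * dist y x := fun y hy =>
    le_of_tendsto ((hlim y (hrW hy)).dist (hlim x hx)) (Eventually.of_forall fun n => hlip n y hy)
  let δ := min r (r * ε / 8)
  have hδ : 0 < δ := by positivity
  refine ⟨ball x δ, mem_nhdsWithin_of_mem_nhds (ball_mem_nhds x hδ), ?_⟩
  filter_upwards [Metric.tendsto_nhds.1 (hlim x hx) (ε / 2) (by linarith)] with n hn y hy
  have hyr : y ∈ ball x r := ball_subset_ball (min_le_left _ _) hy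
  have hyδ : 2 / r * dist y x ≤ ε / 4 := by
    have : dist y x ≤ r * ε / 8 := (mem_ball.1 hy).le.trans (min_le_right _ _)
    calc 2 / r * dist y x ≤ 2 / r * (r * ε / 8) := by gcongr
      _ = ε / 4 := by field_simp; ring
  have h1 := hlip n y hyr
  have h2 := hlipf y hyr
  have h3 := dist_triangle4 (f y) (f x) (F n x) (F n y)
  rw [dist_comm (f x), dist_comm (F n x) (F n y)] at h3
  linarith

/-- The disk automorphism moving `c` to the origin. -/
noncomputable def mobius (c w : ℂ) : ℂ := (w - c) / (1 - (starRingEnd ℂ) c * w)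

theorem one_sub_conj_mul_ne_zero {c w : ℂ} (hc : ‖c‖ < 1) (hw : ‖w‖ < 1) :
    1 - (starRingEnd ℂ) c * w ≠ 0 := by
  intro h
  have h1 : ‖(starRingEnd ℂ) c * w‖ = 1 := by rw [← sub_eq_zero.1 h, norm_one]
  rw [norm_mul, RCLike.norm_conj] at h1
  nlinarith [norm_nonneg c, norm_nonneg w]

theorem norm_mobius_lt_one {c w : ℂ} (hc : ‖c‖ < 1) (hw : ‖w‖ < 1) : ‖mobius c w‖ < 1 := by
  have h0 := one_sub_conj_mul_ne_zero hc hw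
  rw [mobius, norm_div, div_lt_one (norm_pos_iff.2 h0)]
  refine lt_of_pow_lt_pow_left₀ 2 (norm_nonneg _) ?_
  have hc2 : ‖c‖ ^ 2 < 1 := by nlinarith [norm_nonneg c]
  have hw2 : ‖w‖ ^ 2 < 1 := by nlinarith [norm_nonneg w]
  rw [Complex.sq_norm, Complex.normSq_apply] at hc2 hw2 ⊢
  rw [Complex.sq_norm, Complex.normSq_apply]
  simp only [Complex.sub_re, Complex.sub_im, Complex.mul_re, Complex.mul_im, Complex.conj_re,
    Complex.conj_im, Complex.one_re, Complex.one_im]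
  nlinarith [mul_pos (sub_pos.2 hc2) (sub_pos.2 hw2)]

theorem mobius_injOn {c : ℂ} (hc : ‖c‖ < 1) : InjOn (mobius c) (ball 0 1) := by
  intro x hx y hy h
  rw [mem_ball_zero_iff] at hx hy
  have hx0 := one_sub_conj_mul_ne_zero hc hx
  have hy0 := one_sub_conj_mul_ne_zero hc hy
  have hc0 := one_sub_conj_mul_ne_zero hc hc
  rw [mobius, mobius, div_eq_div_iff hx0 hy0] at h
  refine mul_right_cancel₀ hc0 ?_
  linear_combination h

theorem hasDerivAt_mobius {c w : ℂ} (hc : ‖c‖ < 1) (hw : ‖w‖ < 1) :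
    HasDerivAt (mobius c)
      ((1 - (starRingEnd ℂ) c * c) / (1 - (starRingEnd ℂ) c * w) ^ 2) w := by
  have h := ((hasDerivAt_id w).sub_const c).div
    (((hasDerivAt_id w).const_mul ((starRingEnd ℂ) c)).const_sub 1) (one_sub_conj_mul_ne_zero hc hw)
  refine h.congr_deriv ?_
  simp only [id]
  congr 1
  ring

theorem mobius_eq_zero_iff {c w : ℂ} (hc : ‖c‖ < 1) (hw : ‖w‖ < 1) : mobius c w = 0 ↔ w = c := by
  rw [mobius, div_eq_zero_iff, sub_eq_zero]
  exact or_iff_left (one_sub_conj_mul_ne_zero hc hw)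

/-- Conformal embeddings of `W` into the unit disk sending `z₀` to the origin. -/
structure IsDiskEmbedding (W : Set ℂ) (z₀ : ℂ) (f : ℂ → ℂ) : Prop where
  differentiableOn : DifferentiableOn ℂ f W
  mapsTo : MapsTo f W (ball 0 1)
  injOn : InjOn f W
  deriv_ne_zero : ∀ z ∈ W, deriv f z ≠ 0
  map_base : f z₀ = 0

/-- Koebe's square root transformation. -/
theorem IsDiskEmbedding.exists_norm_deriv_lt {W : Set ℂ} {z₀ : ℂ} {f : ℂ → ℂ}
    (hf : IsDiskEmbedding W z₀ f) (hW : IsOpen W) (hz₀ : z₀ ∈ W) (hWc : IsPreconnected W)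
    (hb : Bornology.IsBounded W) (hc : IsPreconnected Wᶜ) {c : ℂ} (hc1 : ‖c‖ < 1)
    (hcf : c ∉ f '' W) :
    ∃ T, IsDiskEmbedding W z₀ T ∧ ‖deriv f z₀‖ < ‖deriv T z₀‖ := by
  have hfm : ∀ z ∈ W, ‖f z‖ < 1 := fun z hz => mem_ball_zero_iff.1 (hf.mapsTo hz)
  have hfd : ∀ z ∈ W, HasDerivAt f (deriv f z) z := fun z hz =>
    (hf.differentiableOn.differentiableAt (hW.mem_nhds hz)).hasDerivAt
  set g : ℂ → ℂ := fun z => mobius c (f z) with hg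
  have hgd : ∀ z ∈ W, HasDerivAt g ((1 - (starRingEnd ℂ) c * c) /
      (1 - (starRingEnd ℂ) c * f z) ^ 2 * deriv f z) z := fun z hz =>
    (hasDerivAt_mobius hc1 (hfm z hz)).comp z (hfd z hz)
  have hg0 : ∀ z ∈ W, g z ≠ 0 := fun z hz h =>
    hcf ⟨z, hz, (mobius_eq_zero_iff hc1 (hfm z hz)).1 h⟩
  obtain ⟨L, hL, hexp⟩ := exists_log_of_isPreconnected_compl hW hWc hb hc
    (fun z hz => (hgd z hz).differentiableAt.differentiableWithinAt) hg0
  set S : ℂ → ℂ := fun z => Complex.exp (L z / 2) with hS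
  have hSsq : ∀ z ∈ W, S z ^ 2 = g z := by
    intro z hz
    rw [hS, ← hexp z hz, ← Complex.exp_nat_mul]
    congr 1
    push_cast
    ring
  have hS0 : ∀ z, S z ≠ 0 := fun z => Complex.exp_ne_zero _
  have hSd : ∀ z ∈ W, HasDerivAt S (deriv S z) z := fun z hz =>
    ((hL.differentiableAt (hW.mem_nhds hz)).div_const 2).cexp.hasDerivAt
  have hSderiv : ∀ z ∈ W, 2 * S z * deriv S z = (1 - (starRingEnd ℂ) c * c) /
      (1 - (starRingEnd ℂ) c * f z) ^ 2 * deriv f z := by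
    intro z hz
    have h1 : HasDerivAt (fun y => S y ^ 2) (2 * S z * deriv S z) z := by
      refine ((hSd z hz).pow 2).congr_deriv ?_
      simp
    refine h1.unique ((hgd z hz).congr_of_eventuallyEq ?_)
    filter_upwards [hW.mem_nhds hz] with y hy using hSsq y hy
  have hS1 : ∀ z ∈ W, ‖S z‖ < 1 := by
    intro z hz
    have h1 : ‖S z‖ ^ 2 < 1 := by
      rw [← norm_pow, hSsq z hz]
      exact norm_mobius_lt_one hc1 (hfm z hz)
    nlinarith [norm_nonneg (S z)]
  set d := S z₀ with hd
  have hd1 : ‖d‖ < 1 := hS1 z₀ hz₀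
  have hSinj : InjOn S W := by
    intro x hx y hy hxy
    refine hf.injOn hx hy (mobius_injOn hc1 (hf.mapsTo hx) (hf.mapsTo hy) ?_)
    change g x = g y
    rw [← hSsq x hx, ← hSsq y hy, hxy]
  have hTd : ∀ z ∈ W, HasDerivAt (fun y => mobius d (S y)) ((1 - (starRingEnd ℂ) d * d) /
      (1 - (starRingEnd ℂ) d * S z) ^ 2 * deriv S z) z := fun z hz =>
    (hasDerivAt_mobius hd1 (hS1 z hz)).comp z (hSd z hz)
  refine ⟨fun z => mobius d (S z), ⟨fun z hz => (hTd z hz).differentiableAt.differentiableWithinAt,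
    fun z hz => mem_ball_zero_iff.2 (norm_mobius_lt_one hd1 (hS1 z hz)), ?_, ?_, ?_⟩, ?_⟩
  · intro x hx y hy hxy
    exact hSinj hx hy (mobius_injOn hd1 (mem_ball_zero_iff.2 (hS1 x hx))
      (mem_ball_zero_iff.2 (hS1 y hy)) hxy)
  · intro z hz
    rw [(hTd z hz).deriv]
    refine mul_ne_zero (div_ne_zero (one_sub_conj_mul_ne_zero hd1 hd1)
      (pow_ne_zero _ (one_sub_conj_mul_ne_zero hd1 (hS1 z hz)))) fun h => ?_
    have h1 := hSderiv z hz
    rw [h, mul_zero] at h1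
    exact mul_ne_zero (div_ne_zero (one_sub_conj_mul_ne_zero hc1 hc1)
      (pow_ne_zero _ (one_sub_conj_mul_ne_zero hc1 (hfm z hz)))) (hf.deriv_ne_zero z hz) h1.symm
  · exact (mobius_eq_zero_iff hd1 hd1).2 rfl
  · rw [(hTd z₀ hz₀).deriv]
    have hdc : ‖d‖ ^ 2 = ‖c‖ := by
      rw [hd, ← norm_pow, hSsq z₀ hz₀, hg]
      simp [mobius, hf.map_base]
    have hd0 : 0 < ‖d‖ := norm_pos_iff.2 (hS0 z₀)
    have h1 := congrArg norm (hSderiv z₀ hz₀)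
    have hcc : ∀ w : ℂ, ‖w‖ < 1 → ‖1 - (starRingEnd ℂ) w * w‖ = 1 - ‖w‖ ^ 2 := by
      intro w hw
      have : 1 - (starRingEnd ℂ) w * w = ((1 - ‖w‖ ^ 2 : ℝ) : ℂ) := by
        rw [mul_comm, Complex.mul_conj, Complex.normSq_eq_norm_sq]
        push_cast
        ring
      rw [this, Complex.norm_real, Real.norm_eq_abs, abs_of_pos]
      nlinarith [norm_nonneg w]
    rw [hf.map_base, ← hd] at h1
    simp only [mul_zero, sub_zero, one_pow, div_one, norm_mul, hcc c hc1, Complex.norm_ofNat,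
      ← hdc] at h1
    have hf0 : 0 < ‖deriv f z₀‖ := norm_pos_iff.2 (hf.deriv_ne_zero z₀ hz₀)
    have hpos : 0 < 1 - ‖d‖ ^ 2 := by nlinarith
    rw [← hd, norm_mul, norm_div, norm_pow, hcc d hd1]
    have h2 : (1 - ‖d‖ ^ 2) / (1 - ‖d‖ ^ 2) ^ 2 * ‖deriv S z₀‖ = ‖deriv S z₀‖ / (1 - ‖d‖ ^ 2) := by
      field_simp
    rw [h2, lt_div_iff₀ hpos]
    have h3 : ‖deriv S z₀‖ = (1 - ‖d‖ ^ 2) * (1 + ‖d‖ ^ 2) * ‖deriv f z₀‖ / (2 * ‖d‖) := by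
      field_simp
      linear_combination h1
    rw [h3, lt_div_iff₀ (by positivity)]
    have h4 : 0 < (1 - ‖d‖ ^ 2) * ‖deriv f z₀‖ := mul_pos hpos hf0
    nlinarith [mul_pos h4 (pow_pos (sub_pos.2 hd1) 2)]

theorem exists_isDiskEmbedding_isMax {W : Set ℂ} (hW : IsOpen W) (hWc : IsPreconnected W)
    (hb : Bornology.IsBounded W) {z₀ : ℂ} (hz₀ : z₀ ∈ W) :
    ∃ f, IsDiskEmbedding W z₀ f ∧ ∀ T, IsDiskEmbedding W z₀ T → ‖deriv T z₀‖ ≤ ‖deriv f z₀‖ := by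
  let A : Set ℝ := (fun f => ‖deriv f z₀‖) '' {f | IsDiskEmbedding W z₀ f}
  obtain ⟨r, hr, hrW⟩ := Metric.isOpen_iff.1 hW z₀ hz₀
  have hAb : BddAbove A := by
    refine ⟨1 / r, ?_⟩
    rintro _ ⟨f, hf, rfl⟩
    refine Complex.norm_deriv_le_div_of_mapsTo_ball (hf.differentiableOn.mono hrW) ?_ hr
    rw [hf.map_base]
    exact (hf.mapsTo.mono_left hrW).mono_right ball_subset_closedBall
  obtain ⟨R, hR0, hR⟩ := hb.subset_ball_lt 0 z₀
  have hinit : IsDiskEmbedding W z₀ (fun z => (z - z₀) / R) := by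
    have hRC : (R : ℂ) ≠ 0 := by exact_mod_cast hR0.ne'
    have hd : ∀ z, HasDerivAt (fun z => (z - z₀) / (R : ℂ)) (1 / R) z := fun z =>
      ((hasDerivAt_id z).sub_const z₀).div_const _
    refine ⟨fun z _ => (hd z).differentiableAt.differentiableWithinAt, fun z hz => ?_,
      fun x _ y _ hxy => ?_, fun z _ => ?_, by simp⟩
    · have := hR hz
      rw [mem_ball, dist_eq_norm] at this
      rw [mem_ball_zero_iff, norm_div, Complex.norm_real, Real.norm_eq_abs, abs_of_pos hR0,
        div_lt_one hR0]
      exact this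
    · have hxy' : (x - z₀) / (R : ℂ) = (y - z₀) / R := hxy
      rwa [div_left_inj' hRC, sub_left_inj] at hxy'
    · rw [(hd z).deriv]
      exact one_div_ne_zero hRC
  have hAne : A.Nonempty := ⟨_, _, hinit, rfl⟩
  obtain ⟨u, -, hu, huA⟩ := exists_seq_tendsto_sSup hAne hAb
  choose F hF hFu using huA
  let 𝒰 : Ultrafilter ℕ := hyperfilter ℕ
  have h𝒰 : (𝒰 : Filter ℕ) ≤ atTop := Nat.hyperfilter_le_atTop
  have hex : ∀ z ∈ W, ∃ w, Tendsto (fun n => F n z) 𝒰 (𝓝 w) := by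
    intro z hz
    obtain ⟨w, -, hw⟩ := (isCompact_closedBall (0 : ℂ) 1).ultrafilter_le_nhds
      (𝒰.map (fun n => F n z)) (by
        rw [le_principal_iff]
        exact Ultrafilter.mem_coe.2 (Ultrafilter.mem_map.2 (Eventually.of_forall fun n =>
          ball_subset_closedBall ((hF n).mapsTo hz))))
    exact ⟨w, hw⟩
  choose! f hlim using hex
  have hloc : TendstoLocallyUniformlyOn F f (𝒰 : Filter ℕ) W :=
    tendstoLocallyUniformlyOn_of_tendsto hW
    (fun n => (hF n).differentiableOn)
    (fun n z hz => (mem_ball_zero_iff.1 ((hF n).mapsTo hz)).le) hlim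
  have hfd : DifferentiableOn ℂ f W :=
    hloc.differentiableOn (Eventually.of_forall fun n => (hF n).differentiableOn) hW
  have hloc' := hloc.deriv (Eventually.of_forall fun n => (hF n).differentiableOn) hW
  have hderiv : ‖deriv f z₀‖ = sSup A := by
    refine tendsto_nhds_unique (hloc'.tendsto_at hz₀).norm ?_
    refine (hu.mono_left h𝒰).congr fun n => ?_
    exact (hFu n).symm
  have hmax : ∀ T, IsDiskEmbedding W z₀ T → ‖deriv T z₀‖ ≤ ‖deriv f z₀‖ := fun T hT => by
    rw [hderiv]
    exact le_csSup hAb ⟨T, hT, rfl⟩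
  have hf'0 : deriv f z₀ ≠ 0 := by
    rw [← norm_pos_iff]
    exact (norm_pos_iff.2 (hinit.deriv_ne_zero z₀ hz₀)).trans_le (hmax _ hinit)
  have hfz₀ : f z₀ = 0 := by
    refine tendsto_nhds_unique (hlim z₀ hz₀) ?_
    simp [(hF _).map_base]
  have hfan : AnalyticOnNhd ℂ f W := hfd.analyticOnNhd hW
  have hnonconst : ∀ b ∈ W, ¬ ∀ᶠ z in 𝓝 b, f z = f b := by
    intro b hb' hev
    refine hf'0 ?_
    have := hfan.eqOn_of_preconnected_of_eventuallyEq (g := fun _ => f b) analyticOnNhd_const hWc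
      hb' hev
    have hev' : f =ᶠ[𝓝 z₀] fun _ => f b := by
      filter_upwards [hW.mem_nhds hz₀] with y hy using this hy
    rw [hev'.deriv_eq, deriv_const]
  refine ⟨f, ⟨hfd, ?_, ?_, ?_, hfz₀⟩, hmax⟩
  · have hle : ∀ z ∈ W, ‖f z‖ ≤ 1 := fun z hz =>
      le_of_tendsto (hlim z hz).norm (Eventually.of_forall fun n =>
        (mem_ball_zero_iff.1 ((hF n).mapsTo hz)).le)
    intro z hz
    rw [mem_ball_zero_iff]
    refine (hle z hz).lt_of_ne fun h1 => hnonconst z hz ?_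
    have hmx : IsLocalMax (norm ∘ f) z := by
      filter_upwards [hW.mem_nhds hz] with y hy
      simpa [h1] using hle y hy
    exact Complex.eventually_eq_of_isLocalMax_norm
      (hfd.eventually_differentiableAt (hW.mem_nhds hz)) hmx
  · intro a ha b hb' hab
    by_contra hne
    have hne' : b ∈ W \ {a} := ⟨hb', fun h => hne h.symm⟩
    have hWa : IsOpen (W \ {a}) := hW.sdiff isClosed_singleton
    have hconst : TendstoLocallyUniformlyOn (fun (n : ℕ) (_ : ℂ) => F n a) (fun _ => f a)
        (𝒰 : Filter ℕ) (W \ {a}) := by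
      rw [Metric.tendstoLocallyUniformlyOn_iff]
      intro ε hε x _
      refine ⟨univ, univ_mem, ?_⟩
      filter_upwards [Metric.tendsto_nhds.1 (hlim a ha) ε hε] with n hn y _
      rwa [dist_comm]
    have hlim' : TendstoLocallyUniformlyOn (fun n z => F n z - F n a) (fun z => f z - f a)
        (𝒰 : Filter ℕ)        (W \ {a}) := (hloc.mono sdiff_subset).sub hconst
    have := eventually_eq_zero_of_tendstoLocallyUniformlyOn hWa
      (fun n => ((hF n).differentiableOn.mono sdiff_subset).sub_const _)
      (fun n z hz h => hz.2 ((hF n).injOn hz.1 ha (sub_eq_zero.1 h))) hlim' hne'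
      (sub_eq_zero.2 hab.symm)
    refine hnonconst b hb' ?_
    filter_upwards [this] with z hz
    rw [sub_eq_zero.1 hz, hab]
  · intro b hb' h0
    have := eventually_eq_zero_of_tendstoLocallyUniformlyOn hW
      (fun n => ((hF n).differentiableOn.deriv hW)) (fun n => (hF n).deriv_ne_zero) hloc' hb' h0
    have hz := (hfd.deriv hW).analyticOnNhd hW
    exact hf'0 (hz.eqOn_zero_of_preconnected_of_eventuallyEq_zero hWc hb' this hz₀)

/-- The **Riemann mapping theorem** for bounded plane domains with connected complement. -/
theorem exists_riemann_map {W : Set ℂ} (hW : IsOpen W) (hne : W.Nonempty) (hWc : IsPreconnected W)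
    (hb : Bornology.IsBounded W) (hc : IsPreconnected Wᶜ) :
    ∃ f g : ℂ → ℂ, DifferentiableOn ℂ f (ball 0 1) ∧ DifferentiableOn ℂ g W ∧
      MapsTo f (ball 0 1) W ∧ MapsTo g W (ball 0 1) ∧
      LeftInvOn g f (ball 0 1) ∧ LeftInvOn f g W := by
  obtain ⟨z₀, hz₀⟩ := hne
  obtain ⟨g, hg, hmax⟩ := exists_isDiskEmbedding_isMax hW hWc hb hz₀
  have himg : g '' W = ball 0 1 := by
    refine subset_antisymm hg.mapsTo.image_subset fun c hc1 => ?_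
    by_contra hcg
    obtain ⟨T, hT, hlt⟩ := hg.exists_norm_deriv_lt hW hz₀ hWc hb hc (mem_ball_zero_iff.1 hc1) hcg
    exact absurd (hmax T hT) (not_le.2 hlt)
  have hinv : LeftInvOn (Function.invFunOn g W) g W := hg.injOn.leftInvOn_invFunOn
  refine ⟨Function.invFunOn g W, g, ?_, hg.differentiableOn, ?_, hg.mapsTo, ?_, hinv⟩
  · rw [← himg]
    rintro _ ⟨z, hz, rfl⟩
    have hsd : HasStrictDerivAt g (deriv g z) z :=
      ((hg.differentiableOn.analyticAt (hW.mem_nhds hz)).contDiffAt (n := 1)).hasStrictDerivAt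
        one_ne_zero
    have hmap := hsd.map_nhds_eq (hg.deriv_ne_zero z hz)
    have hcont : ContinuousAt (Function.invFunOn g W) (g z) := by
      rw [ContinuousAt, hinv hz, ← hmap, tendsto_map'_iff]
      refine tendsto_id.congr' ?_
      filter_upwards [hW.mem_nhds hz] with y hy using (hinv hy).symm
    refine (HasDerivAt.of_local_left_inverse (f := g) (f' := deriv g z) hcont ?_
      (hg.deriv_ne_zero z hz) ?_).differentiableAt.differentiableWithinAt
    · rw [hinv hz]
      exact hsd.hasDerivAt
    · rw [← hmap, eventually_map]
      filter_upwards [hW.mem_nhds hz] with y hy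
      rw [hinv hy]
  · rw [← himg]
    rintro _ ⟨x, hx, rfl⟩
    rwa [hinv hx]
  · rw [← himg]
    rintro _ ⟨x, hx, rfl⟩
    rw [hinv hx]

/-! ### Short crosscuts -/

/-- The horizontal strip `0 < im z < π`. -/
def strip : Set ℂ := {z | 0 < z.im ∧ z.im < Real.pi}

theorem isOpen_strip : IsOpen strip :=
  (isOpen_lt continuous_const Complex.continuous_im).inter
    (isOpen_lt Complex.continuous_im continuous_const)

theorem det_restrictScalars_toSpanSingleton (a : ℂ) :
    ((ContinuousLinearMap.toSpanSingleton ℂ a).restrictScalars ℝ).det = ‖a‖ ^ 2 := by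
  rw [← Complex.normSq_eq_norm_sq, ← Algebra.norm_complex_apply, Algebra.norm_apply,
    ContinuousLinearMap.det]
  congr 1
  ext
  simp [mul_comm]

theorem lintegral_enorm_deriv_sq_le {F : ℂ → ℂ} {W : Set ℂ} {s : Set ℂ} (hs : IsOpen s)
    (hF : DifferentiableOn ℂ F s) (hinj : InjOn F s) (hmaps : MapsTo F s W) :
    ∫⁻ z in s, ENNReal.ofReal (‖deriv F z‖ ^ 2) ≤ volume W := by
  have h := lintegral_abs_det_fderiv_eq_addHaar_image volume hs.measurableSet
    (f' := fun z => (ContinuousLinearMap.toSpanSingleton ℂ (deriv F z)).restrictScalars ℝ)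
    (fun z hz => ((hF.differentiableAt (hs.mem_nhds hz)).hasDerivAt.hasFDerivAt.restrictScalars
      ℝ).hasFDerivWithinAt) hinj
  simp only [det_restrictScalars_toSpanSingleton, abs_pow, abs_norm] at h
  rw [h]
  exact measure_mono hmaps.image_subset

theorem exists_lintegral_lt {G : ℂ → ENNReal} (hG : Measurable (strip.indicator G))
    (hfin : ∫⁻ z in strip, G z ≠ ⊤) {ε : ENNReal} (hε : ε ≠ 0) (N : ℝ) :
    ∃ s < N, ∫⁻ t in Ioo 0 Real.pi, G (s + t * Complex.I) < ε := by
  by_contra! hcon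
  refine hfin ?_
  rw [← lintegral_indicator isOpen_strip.measurableSet,
    ← Complex.volume_preserving_equiv_real_prod.symm.lintegral_comp hG, Measure.volume_eq_prod,
    lintegral_prod (fun p => strip.indicator G (Complex.measurableEquivRealProd.symm p))
      (hG.comp Complex.measurableEquivRealProd.symm.measurable).aemeasurable]
  have h1 : ∀ s : ℝ, ∫⁻ t : ℝ, strip.indicator G (Complex.measurableEquivRealProd.symm (s, t)) =
      ∫⁻ t in Ioo 0 Real.pi, G (s + t * Complex.I) := by
    intro s
    rw [← lintegral_indicator measurableSet_Ioo]
    refine lintegral_congr fun t => ?_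
    have h2 : Complex.measurableEquivRealProd.symm (s, t) = s + t * Complex.I := by
      apply Complex.ext <;> simp [Complex.measurableEquivRealProd_symm_apply]
    rw [h2]
    by_cases ht : t ∈ Ioo 0 Real.pi
    · rw [indicator_of_mem ht, indicator_of_mem (by simpa [strip] using ht)]
    · rw [indicator_of_notMem ht, indicator_of_notMem (by simpa [strip] using ht)]
  simp_rw [h1]
  refine top_unique ?_
  calc (⊤ : ENNReal) = ∫⁻ _ in Iio N, ε := by
        rw [setLIntegral_const, Real.volume_Iio, ENNReal.mul_top hε]
    _ ≤ ∫⁻ s in Iio N, ∫⁻ t in Ioo 0 Real.pi, G (s + t * Complex.I) :=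
        setLIntegral_mono' measurableSet_Iio hcon
    _ ≤ _ := setLIntegral_le_lintegral _ _

theorem norm_sub_le_of_lintegral_deriv_sq_le {c c' : ℝ → ℂ} {a b E : ℝ} (hE : 0 ≤ E)
    (hc : ∀ t ∈ Ioo a b, HasDerivAt c (c' t) t) (hc' : ContinuousOn c' (Ioo a b))
    (hint : ∫⁻ t in Ioo a b, ENNReal.ofReal (‖c' t‖ ^ 2) ≤ ENNReal.ofReal E) {l : ℝ} (hl : 0 < l)
    {t t' : ℝ} (ht : t ∈ Ioo a b) (ht' : t' ∈ Ioo a b) (htt : t ≤ t') :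
    ‖c t' - c t‖ ≤ l * (t' - t) + E / l := by
  have hsub : Icc t t' ⊆ Ioo a b := fun x hx => ⟨ht.1.trans_le hx.1, hx.2.trans_lt ht'.2⟩
  have hsub' : uIcc t t' ⊆ Ioo a b := by rwa [uIcc_of_le htt]
  have hci : IntervalIntegrable c' volume t t' := (hc'.mono hsub').intervalIntegrable
  have hcn : IntervalIntegrable (fun x => ‖c' x‖ ^ 2) volume t t' :=
    ((hc'.mono hsub').norm.pow 2).intervalIntegrable
  rw [← intervalIntegral.integral_eq_sub_of_hasDerivAt (fun x hx => hc x (hsub' hx)) hci]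
  have h2 : ∫ x in t..t', ‖c' x‖ ^ 2 ≤ E := by
    rw [intervalIntegral.integral_of_le htt, integral_eq_lintegral_of_nonneg_ae
      (Eventually.of_forall fun x => by positivity)
      (by simpa using (hcn.1).aestronglyMeasurable)]
    refine ENNReal.toReal_le_of_le_ofReal hE (le_trans ?_ hint)
    exact lintegral_mono_set (Ioc_subset_Icc_self.trans hsub)
  calc ‖∫ x in t..t', c' x‖ ≤ ∫ x in t..t', ‖c' x‖ :=
        intervalIntegral.norm_integral_le_integral_norm htt
    _ ≤ ∫ x in t..t', (l + ‖c' x‖ ^ 2 / l) := by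
        refine intervalIntegral.integral_mono_on htt hci.norm
          (intervalIntegrable_const.add (hcn.div_const l)) fun x _ => ?_
        have h3 : l + ‖c' x‖ ^ 2 / l - ‖c' x‖ = ((‖c' x‖ - l / 2) ^ 2 + 3 / 4 * l ^ 2) / l := by
          field_simp
          ring
        have h4 : 0 ≤ ((‖c' x‖ - l / 2) ^ 2 + 3 / 4 * l ^ 2) / l := by positivity
        linarith
    _ = l * (t' - t) + (∫ x in t..t', ‖c' x‖ ^ 2) / l := by
        rw [intervalIntegral.integral_add intervalIntegrable_const (hcn.div_const l),
          intervalIntegral.integral_const, intervalIntegral.integral_div, smul_eq_mul, mul_comm]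
    _ ≤ l * (t' - t) + E / l := by gcongr

theorem exists_short_crosscut {F : ℂ → ℂ} {W : Set ℂ} (hW : Bornology.IsBounded W)
    (hF : DifferentiableOn ℂ F strip) (hinj : InjOn F strip) (hmaps : MapsTo F strip W)
    {δ : ℝ} (hδ : 0 < δ) (N : ℝ) :
    ∃ s < N, ∃ c : ℝ → ℂ, ContinuousOn c (Icc 0 Real.pi) ∧
      (∀ t ∈ Ioo 0 Real.pi, c t = F (s + t * Complex.I)) ∧
      ∀ t ∈ Icc 0 Real.pi, ∀ t' ∈ Icc 0 Real.pi, dist (c t) (c t') ≤ δ := by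
  have hd : ContinuousOn (deriv F) strip := (hF.deriv isOpen_strip).continuousOn
  have hmeas : Measurable (strip.indicator fun z => ENNReal.ofReal (‖deriv F z‖ ^ 2)) := by
    have : Measurable (fun z => ENNReal.ofReal (‖deriv F z‖ ^ 2)) :=
      ((measurable_deriv F).norm.pow_const 2).ennreal_ofReal
    exact this.indicator isOpen_strip.measurableSet
  have hE : 0 < δ ^ 2 / 16 := by positivity
  obtain ⟨s, hsN, hs⟩ := exists_lintegral_lt hmeas
    ((lintegral_enorm_deriv_sq_le isOpen_strip hF hinj hmaps).trans_lt hW.measure_lt_top).ne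
    (ENNReal.ofReal_pos.2 hE).ne' N
  have hmem : ∀ t ∈ Ioo 0 Real.pi, (s + t * Complex.I : ℂ) ∈ strip := fun t ht => by
    simpa [strip] using ht
  have hline : ∀ t : ℝ, HasDerivAt (fun t : ℝ => (s + t * Complex.I : ℂ)) Complex.I t := fun t => by
    simpa using ((Complex.ofRealCLM.hasDerivAt (x := t)).mul_const Complex.I).const_add (s : ℂ)
  let k : ℝ → ℂ := fun t => F (s + t * Complex.I)
  let k' : ℝ → ℂ := fun t => deriv F (s + t * Complex.I) * Complex.I
  have hk : ∀ t ∈ Ioo 0 Real.pi, HasDerivAt k (k' t) t := fun t ht =>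
    (hF.differentiableAt (isOpen_strip.mem_nhds (hmem t ht))).hasDerivAt.comp t (hline t)
  have hk' : ContinuousOn k' (Ioo 0 Real.pi) :=
    (hd.comp (by fun_prop) hmem).mul continuousOn_const
  have hint : ∫⁻ t in Ioo 0 Real.pi, ENNReal.ofReal (‖k' t‖ ^ 2) ≤ ENNReal.ofReal (δ ^ 2 / 16) := by
    simpa [k'] using hs.le
  have hbound : ∀ l > 0, ∀ t ∈ Ioo 0 Real.pi, ∀ t' ∈ Ioo 0 Real.pi,
      dist (k t) (k t') ≤ l * dist t t' + δ ^ 2 / 16 / l := by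
    intro l hl t ht t' ht'
    rcases le_total t t' with h | h
    · rw [dist_comm, dist_eq_norm, dist_comm, Real.dist_eq, abs_of_nonneg (sub_nonneg.2 h)]
      exact norm_sub_le_of_lintegral_deriv_sq_le hE.le hk hk' hint hl ht ht' h
    · rw [dist_eq_norm, Real.dist_eq, abs_of_nonneg (sub_nonneg.2 h)]
      exact norm_sub_le_of_lintegral_deriv_sq_le hE.le hk hk' hint hl ht' ht h
  have huc : UniformContinuousOn k (Ioo 0 Real.pi) := by
    rw [Metric.uniformContinuousOn_iff]
    intro ε hε
    set l := δ ^ 2 / (8 * ε) with hl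
    have hl0 : 0 < l := by positivity
    refine ⟨ε / (2 * l), by positivity, fun t ht t' ht' hlt => ?_⟩
    refine (hbound l hl0 t ht t' ht').trans_lt ?_
    have h1 : l * dist t t' < l * (ε / (2 * l)) := by gcongr
    have h2 : l * (ε / (2 * l)) = ε / 2 := by field_simp
    have h3 : δ ^ 2 / 16 / l = ε / 2 := by rw [hl]; field_simp; norm_num
    linarith
  have hlim : ∀ x (l : Filter ℝ), l.NeBot → l ≤ 𝓝 x → l ≤ 𝓟 (Ioo 0 Real.pi) →
      ∃ w, Tendsto k l (𝓝 w) := fun x l hl hx hI =>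
    cauchy_map_iff_exists_tendsto.1 ((cauchy_nhds.mono hx).map_of_le huc hI)
  obtain ⟨w₁, hw₁⟩ := hlim 0 (𝓝[>] 0) inferInstance nhdsWithin_le_nhds
    (le_principal_iff.2 (Ioo_mem_nhdsGT Real.pi_pos))
  obtain ⟨w₂, hw₂⟩ := hlim Real.pi (𝓝[<] Real.pi) inferInstance nhdsWithin_le_nhds
    (le_principal_iff.2 (Ioo_mem_nhdsLT Real.pi_pos))
  have hcc := continuousOn_Icc_extendFrom_Ioo huc.continuousOn hw₁ hw₂
  have hce : ∀ t ∈ Ioo 0 Real.pi, extendFrom (Ioo 0 Real.pi) k t = k t := fun t ht =>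
    extendFrom_eq (subset_closure ht) (huc.continuousOn t ht)
  refine ⟨s, hsN, extendFrom (Ioo 0 Real.pi) k, hcc, hce, ?_⟩
  have hcl : Icc 0 Real.pi = closure (Ioo 0 Real.pi) := (closure_Ioo Real.pi_pos.ne).symm
  have hkey : ∀ p ∈ Icc (0 : ℝ) Real.pi ×ˢ Icc (0 : ℝ) Real.pi,
      dist (extendFrom (Ioo 0 Real.pi) k p.1) (extendFrom (Ioo 0 Real.pi) k p.2) ≤ δ := by
    have hcp : ContinuousOn (fun p : ℝ × ℝ => dist (extendFrom (Ioo 0 Real.pi) k p.1)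
        (extendFrom (Ioo 0 Real.pi) k p.2)) (closure (Ioo 0 Real.pi ×ˢ Ioo 0 Real.pi)) := by
      rw [closure_prod_eq, ← hcl]
      exact continuous_dist.comp_continuousOn <| ContinuousOn.prodMk
        (ContinuousOn.comp hcc continuousOn_fst fun p hp => (mem_prod.1 hp).1)
        (ContinuousOn.comp hcc continuousOn_snd fun p hp => (mem_prod.1 hp).2)
    intro p hp
    rw [hcl, ← closure_prod_eq] at hp
    refine le_on_closure (fun q hq => ?_) hcp continuousOn_const hp
    rw [hce _ hq.1, hce _ hq.2]
    refine (hbound (δ / 8) (by positivity) _ hq.1 _ hq.2).trans ?_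
    have h1 : dist q.1 q.2 ≤ 4 := by
      refine (Real.dist_le_of_mem_Icc (Ioo_subset_Icc_self hq.1)
        (Ioo_subset_Icc_self hq.2)).trans ?_
      linarith [Real.pi_le_four]
    have h2 : δ / 8 * dist q.1 q.2 ≤ δ / 8 * 4 := by gcongr
    have h3 : δ ^ 2 / 16 / (δ / 8) = δ / 2 := by field_simp; norm_num
    linarith
  exact fun t ht t' ht' => hkey (t, t') ⟨ht, ht'⟩

/-! ### Boundary behaviour of Riemann maps -/

theorem isPreconnected_compl_closedBall {p : ℂ} {r : ℝ} :
    IsPreconnected (closedBall p r)ᶜ := by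
  have himg : (fun q : ℝ × ℝ => p + q.1 * Complex.exp (q.2 * Complex.I)) '' (Ioi r ×ˢ univ) =
      (closedBall p r)ᶜ := by
    ext z
    simp only [mem_image, mem_prod, mem_Ioi, mem_univ, and_true, mem_compl_iff, mem_closedBall,
      not_le, Prod.exists, dist_eq_norm]
    constructor
    · rintro ⟨ρ, θ, h, rfl⟩
      rw [add_sub_cancel_left, norm_mul, Complex.norm_exp_ofReal_mul_I, mul_one, Complex.norm_real,
        Real.norm_eq_abs]
      exact h.trans_le (le_abs_self _)
    · intro h
      exact ⟨‖z - p‖, Complex.arg (z - p), h, by rw [Complex.norm_mul_exp_arg_mul_I]; ring⟩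
  rw [← himg]
  exact ((convex_Ioi r).prod convex_univ).isPreconnected.image _ (by fun_prop)

/-- The conformal map from the strip onto the unit disk whose ends go to `ζ` and `-ζ`. -/
noncomputable def stripMap (ζ u : ℂ) : ℂ :=
  ζ * ((Complex.I - Complex.exp u) / (Complex.I + Complex.exp u))

theorem exp_im_pos {u : ℂ} (hu : u ∈ strip) : 0 < (Complex.exp u).im := by
  rw [Complex.exp_im]
  exact mul_pos (Real.exp_pos _) (Real.sin_pos_of_pos_of_lt_pi hu.1 hu.2)

theorem I_add_ne_zero {w : ℂ} (hw : 0 ≤ w.im) : Complex.I + w ≠ 0 := fun h => by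
  have := congrArg Complex.im h
  simp at this
  linarith

theorem stripMap_mem_ball {ζ u : ℂ} (hζ : ‖ζ‖ = 1) (hu : u ∈ strip) : stripMap ζ u ∈ ball 0 1 := by
  have h := exp_im_pos hu
  have h0 := I_add_ne_zero h.le
  rw [mem_ball_zero_iff, stripMap, norm_mul, hζ, one_mul, norm_div, div_lt_one (norm_pos_iff.2 h0)]
  refine lt_of_pow_lt_pow_left₀ 2 (norm_nonneg _) ?_
  rw [Complex.sq_norm, Complex.normSq_apply, Complex.sq_norm, Complex.normSq_apply]
  simp only [Complex.sub_re, Complex.sub_im, Complex.add_re, Complex.add_im, Complex.I_re,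
    Complex.I_im]
  nlinarith

theorem differentiableAt_stripMap {ζ u : ℂ} (hu : 0 ≤ (Complex.exp u).im) :
    DifferentiableAt ℂ (stripMap ζ) u := by
  unfold stripMap
  have := I_add_ne_zero hu
  fun_prop (disch := assumption)

theorem stripMap_injOn {ζ : ℂ} (hζ : ‖ζ‖ = 1) : InjOn (stripMap ζ) strip := by
  intro u hu v hv h
  have hζ0 : ζ ≠ 0 := norm_pos_iff.1 (by rw [hζ]; exact one_pos)
  have h1 := mul_left_cancel₀ hζ0 h
  rw [div_eq_div_iff (I_add_ne_zero (exp_im_pos hu).le) (I_add_ne_zero (exp_im_pos hv).le)] at h1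
  have h2 : Complex.exp u = Complex.exp v := by
    have h3 : Complex.I * (Complex.exp v - Complex.exp u) = 0 := by linear_combination h1 / 2
    rcases mul_eq_zero.1 h3 with h4 | h4
    · exact absurd h4 Complex.I_ne_zero
    · exact (sub_eq_zero.1 h4).symm
  have hpi := Real.pi_pos
  exact Complex.exp_inj_of_neg_pi_lt_of_le_pi (by linarith [hu.1]) hu.2.le (by linarith [hv.1])
    hv.2.le h2

theorem norm_stripMap_eq_one {ζ u : ℂ} (hζ : ‖ζ‖ = 1) (hu : (Complex.exp u).im = 0) :
    ‖stripMap ζ u‖ = 1 := by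
  have h0 := I_add_ne_zero hu.ge
  rw [stripMap, norm_mul, hζ, one_mul, norm_div, div_eq_one_iff_eq (norm_pos_iff.2 h0).ne']
  rw [← sq_eq_sq₀ (norm_nonneg _) (norm_nonneg _)]
  rw [Complex.sq_norm, Complex.normSq_apply, Complex.sq_norm, Complex.normSq_apply]
  simp [hu]

theorem exists_stripMap_eq {ζ z : ℂ} (hζ : ‖ζ‖ = 1) (hz : z ∈ ball (0 : ℂ) 1) {s : ℝ}
    (hs : ‖ζ - z‖ = Real.exp s * ‖ζ + z‖) :
    ∃ t ∈ Ioo 0 Real.pi, z = stripMap ζ (s + t * Complex.I) := by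
  rw [mem_ball_zero_iff] at hz
  have hp : ζ + z ≠ 0 := fun h => by
    rw [← neg_eq_of_add_eq_zero_right h, norm_neg, hζ] at hz
    exact lt_irrefl _ hz
  set w : ℂ := Complex.I * ((ζ - z) / (ζ + z)) with hw
  have him : 0 < w.im := by
    have h1 : w.im = ((ζ - z) / (ζ + z)).re := by simp [hw]
    rw [h1, Complex.div_re, ← add_div]
    refine div_pos ?_ (Complex.normSq_pos.2 hp)
    have h2 : Complex.normSq ζ = 1 := by rw [Complex.normSq_eq_norm_sq, hζ, one_pow]
    have h3 : Complex.normSq z < 1 := by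
      rw [Complex.normSq_eq_norm_sq]; nlinarith [norm_nonneg z]
    rw [Complex.normSq_apply] at h2 h3
    simp only [Complex.sub_re, Complex.sub_im, Complex.add_re, Complex.add_im]
    nlinarith
  have hw0 : w ≠ 0 := fun h => by rw [h] at him; exact lt_irrefl _ him
  have hnorm : ‖w‖ = Real.exp s := by
    rw [hw, norm_mul, Complex.norm_I, one_mul, norm_div, hs, mul_div_assoc,
      div_self (norm_pos_iff.2 hp).ne', mul_one]
  have hexp : Complex.exp (s + w.arg * Complex.I) = w := by
    rw [Complex.exp_add, ← Complex.ofReal_exp, ← hnorm, Complex.norm_mul_exp_arg_mul_I]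
  refine ⟨w.arg, ⟨?_, Complex.arg_lt_pi_iff.2 (Or.inr him.ne')⟩, ?_⟩
  · refine lt_of_le_of_ne (Complex.arg_nonneg_iff.2 him.le) fun h => ?_
    exact him.ne' (Complex.arg_eq_zero_iff.1 h.symm).2
  · have hζ0 : ζ ≠ 0 := norm_pos_iff.1 (by rw [hζ]; exact one_pos)
    rw [stripMap, hexp]
    have h1 := I_add_ne_zero him.le
    rw [eq_comm, ← mul_div_assoc, div_eq_iff h1, hw]
    field_simp
    ring

/-- A biholomorphic map `f` from the unit disk onto `W`, with inverse `g`. -/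
structure IsRiemannMap (W : Set ℂ) (f g : ℂ → ℂ) : Prop where
  differentiableOn : DifferentiableOn ℂ f (ball 0 1)
  differentiableOn_inv : DifferentiableOn ℂ g W
  mapsTo : MapsTo f (ball 0 1) W
  mapsTo_inv : MapsTo g W (ball 0 1)
  leftInvOn : LeftInvOn g f (ball 0 1)
  rightInvOn : LeftInvOn f g W

theorem IsRiemannMap.mem_frontier {W : Set ℂ} {f g : ℂ → ℂ} (h : IsRiemannMap W f g)
    (hW : IsOpen W) {ι : Type*} {l : Filter ι} [l.NeBot] {u : ι → ℂ} {ζ w : ℂ} (hζ : ‖ζ‖ = 1)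
    (hu : ∀ᶠ i in l, u i ∈ ball (0 : ℂ) 1) (hlim : Tendsto u l (𝓝 ζ))
    (hw : Tendsto (fun i => f (u i)) l (𝓝 w)) : w ∈ frontier W := by
  rw [hW.frontier_eq]
  refine ⟨mem_closure_of_tendsto hw (hu.mono fun i hi => h.mapsTo hi), fun hwW => ?_⟩
  have h1 : Tendsto (fun i => g (f (u i))) l (𝓝 (g w)) :=
    ((h.differentiableOn_inv.continuousOn).continuousAt (hW.mem_nhds hwW)).tendsto.comp hw
  have h2 : g w = ζ := tendsto_nhds_unique (h1.congr' (hu.mono fun i hi => h.leftInvOn hi)) hlim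
  have h3 := mem_ball_zero_iff.1 (h.mapsTo_inv hwW)
  rw [h2, hζ] at h3
  exact lt_irrefl _ h3

/-- Nearby points of the frontier of `W` lie in small connected subsets of the complement. -/
def FrontierLocallyConnected (W : Set ℂ) : Prop :=
  ∀ ε > 0, ∃ δ > 0, ∀ x ∈ frontier W, ∀ y ∈ frontier W, dist x y < δ →
    ∃ B ⊆ Wᶜ, IsClosed B ∧ IsPreconnected B ∧ x ∈ B ∧ y ∈ B ∧ B ⊆ closedBall x ε

theorem IsRiemannMap.exists_mapsTo_closedBall {W : Set ℂ} {f g : ℂ → ℂ} (h : IsRiemannMap W f g)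
    (hW : IsOpen W) (hWc : IsPreconnected W) (hWb : Bornology.IsBounded W)
    (hloc : FrontierLocallyConnected W) {ζ : ℂ} (hζ : ‖ζ‖ = 1) {ε : ℝ} (hε : 0 < ε) :
    ∃ V ∈ 𝓝 ζ, ∃ p, MapsTo f (V ∩ ball 0 1) (closedBall p ε) := by
  have h0 : (0 : ℂ) ∈ ball (0 : ℂ) 1 := mem_ball_self one_pos
  obtain ⟨ρ, hρ, hρW⟩ := Metric.isOpen_iff.1 hW (f 0) (h.mapsTo h0)
  set ε' := min ε (ρ / 2) with hε'
  have hε'0 : 0 < ε' := lt_min hε (by linarith)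
  obtain ⟨δ, hδ, hB⟩ := hloc ε' hε'0
  have hFd : DifferentiableOn ℂ (fun u => f (stripMap ζ u)) strip := fun u hu =>
    ((h.differentiableOn.differentiableAt (isOpen_ball.mem_nhds (stripMap_mem_ball hζ hu))).comp u
      (differentiableAt_stripMap (exp_im_pos hu).le)).differentiableWithinAt
  have hFi : InjOn (fun u => f (stripMap ζ u)) strip := fun u hu v hv huv =>
    stripMap_injOn hζ hu hv (h.leftInvOn.injOn (stripMap_mem_ball hζ hu) (stripMap_mem_ball hζ hv)
      huv)
  obtain ⟨s, hs0, c, hc, hcF, hdist⟩ := exists_short_crosscut hWb hFd hFi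
    (fun u hu => h.mapsTo (stripMap_mem_ball hζ hu))
    (δ := min (δ / 2) ε') (lt_min (by linarith) hε'0) 0
  have hpi := Real.pi_pos
  have hmem : ∀ t ∈ Ioo 0 Real.pi, (s + t * Complex.I : ℂ) ∈ strip := fun t ht => by
    simpa [strip] using ht
  have hend : ∀ τ ∈ Icc 0 Real.pi, Real.sin τ = 0 → c τ ∈ frontier W := by
    intro τ hτ hsin
    have him : (Complex.exp (s + τ * Complex.I)).im = 0 := by
      rw [Complex.exp_im]
      simp [hsin]
    have hne : (𝓝[Ioo 0 Real.pi] τ).NeBot := by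
      rw [← mem_closure_iff_nhdsWithin_neBot, closure_Ioo hpi.ne]
      exact hτ
    refine h.mem_frontier hW (l := 𝓝[Ioo 0 Real.pi] τ)
      (u := fun t => stripMap ζ (s + t * Complex.I)) (norm_stripMap_eq_one hζ him) ?_ ?_ ?_
    · filter_upwards [self_mem_nhdsWithin] with t ht using stripMap_mem_ball hζ (hmem t ht)
    · have h1 : ContinuousAt (fun t : ℝ => stripMap ζ (s + t * Complex.I)) τ :=
        ContinuousAt.comp (f := fun t : ℝ => (s + t * Complex.I : ℂ))
          (differentiableAt_stripMap him.ge).continuousAt (by fun_prop)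
      exact h1.tendsto.mono_left nhdsWithin_le_nhds
    · have h2 : Tendsto c (𝓝[Ioo 0 Real.pi] τ) (𝓝 (c τ)) :=
        (hc τ hτ).mono_left (nhdsWithin_mono _ Ioo_subset_Icc_self)
      refine h2.congr' ?_
      filter_upwards [self_mem_nhdsWithin] with t ht using hcF t ht
  have hm0 : (0 : ℝ) ∈ Icc 0 Real.pi := ⟨le_rfl, hpi.le⟩
  have hmpi : Real.pi ∈ Icc 0 Real.pi := ⟨hpi.le, le_rfl⟩
  have hw₁ := hend 0 hm0 Real.sin_zero
  have hw₂ := hend Real.pi hmpi Real.sin_pi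
  obtain ⟨B, hBW, hBcl, hBc, hB₁, hB₂, hBε⟩ := hB _ hw₁ _ hw₂
    ((hdist _ hm0 _ hmpi).trans_lt ((min_le_left _ _).trans_lt (by linarith)))
  set C := c '' Icc 0 Real.pi with hC
  have hCcl : IsClosed C := (isCompact_Icc.image_of_continuousOn hc).isClosed
  have hEball : B ∪ C ⊆ closedBall (c 0) ε' := by
    refine union_subset hBε ?_
    rintro _ ⟨t, ht, rfl⟩
    exact (hdist t ht 0 hm0).trans (min_le_right _ _)
  have hEW : (B ∪ C) ∩ Wᶜ = B := by
    refine subset_antisymm ?_ fun x hx => ⟨Or.inl hx, hBW hx⟩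
    rintro x ⟨hx | ⟨t, ht, rfl⟩, hxW⟩
    · exact hx
    · rcases eq_or_lt_of_le ht.1 with h1 | h1
      · rwa [← h1]
      rcases eq_or_lt_of_le ht.2 with h2 | h2
      · rwa [h2]
      refine absurd ?_ hxW
      rw [hcF t ⟨h1, h2⟩]
      exact h.mapsTo (stripMap_mem_ball hζ (hmem t ⟨h1, h2⟩))
  have hfar : f 0 ∉ closedBall (c 0) ε' := by
    intro hmem
    have h1 : c 0 ∉ W := by rw [hW.frontier_eq] at hw₁; exact hw₁.2
    refine h1 (hρW ?_)
    rw [mem_ball, dist_comm]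
    refine (mem_closedBall.1 hmem).trans_lt ((min_le_right _ _).trans_lt (by linarith))
  refine ⟨{z | ‖ζ - z‖ < Real.exp s * ‖ζ + z‖}, IsOpen.mem_nhds (isOpen_lt (by fun_prop)
    (by fun_prop)) ?_, c 0, ?_⟩
  · have : ζ + ζ ≠ 0 := by
      rw [← two_mul]
      exact mul_ne_zero two_ne_zero (norm_pos_iff.1 (by rw [hζ]; exact one_pos))
    change ‖ζ - ζ‖ < _
    rw [sub_self, norm_zero]
    exact mul_pos (Real.exp_pos s) (norm_pos_iff.2 this)
  · rintro z ⟨hzV, hz⟩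
    refine closedBall_subset_closedBall (min_le_left ε (ρ / 2)) ?_
    by_contra hzb
    have hJ := mem_connectedComponentIn_union (hBcl.union hCcl) hW.isClosed_compl
      (by rw [hEW]; exact hBc) (hWb.subset fun x hx => by
        by_contra hxW
        exact hx (Or.inr hxW))
      isPreconnected_compl_closedBall hWc
      (disjoint_left.2 fun x hx hxE => hx (hEball hxE)) disjoint_compl_right
      hzb hfar (h.mapsTo hz) (h.mapsTo h0)
    set Q := connectedComponentIn ((B ∪ C) ∪ Wᶜ)ᶜ (f z) with hQ
    have hQsub : Q ⊆ ((B ∪ C) ∪ Wᶜ)ᶜ := connectedComponentIn_subset _ _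
    have hzQ : f z ∈ Q := mem_connectedComponentIn fun hx => by
      rcases hx with hx | hx
      · exact hzb (hEball hx)
      · exact hx (h.mapsTo hz)
    have hQW : Q ⊆ W := fun x hx => by
      by_contra hxW
      exact hQsub hx (Or.inr hxW)
    let φ : ℂ → ℝ := fun w => ‖ζ - g w‖ - Real.exp s * ‖ζ + g w‖
    have hgc : ContinuousOn g Q := h.differentiableOn_inv.continuousOn.mono hQW
    have hφ : ContinuousOn φ Q :=
      (continuousOn_const.sub hgc).norm.sub
        (continuousOn_const.mul (continuousOn_const.add hgc).norm)
    have hφz : φ (f z) ≤ 0 := by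
      simp only [φ, h.leftInvOn hz]
      exact (sub_neg.2 hzV).le
    have hφ0 : 0 ≤ φ (f 0) := by
      simp only [φ, h.leftInvOn h0, sub_zero, add_zero, hζ, mul_one]
      exact sub_nonneg.2 (Real.exp_le_one_iff.2 hs0.le)
    obtain ⟨w, hwQ, hw⟩ := isPreconnected_connectedComponentIn.intermediate_value hzQ hJ hφ
      ⟨hφz, hφ0⟩
    obtain ⟨t, ht, hgt⟩ := exists_stripMap_eq hζ (h.mapsTo_inv (hQW hwQ)) (sub_eq_zero.1 hw)
    refine hQsub hwQ (Or.inl (Or.inr ⟨t, Ioo_subset_Icc_self ht, ?_⟩))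
    rw [hcF t ht, ← hgt, h.rightInvOn (hQW hwQ)]

theorem neBot_nhdsWithin_ball {ζ : ℂ} (hζ : ζ ∈ closedBall (0 : ℂ) 1) :
    (𝓝[ball (0 : ℂ) 1] ζ).NeBot := by
  rw [← mem_closure_iff_nhdsWithin_neBot, closure_ball _ one_ne_zero]
  exact hζ

/-- **Carathéodory's theorem**, extension part. -/
theorem IsRiemannMap.exists_extension {W : Set ℂ} {f g : ℂ → ℂ} (h : IsRiemannMap W f g)
    (hW : IsOpen W) (hWc : IsPreconnected W) (hWb : Bornology.IsBounded W)
    (hloc : FrontierLocallyConnected W) :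
    ∃ F : ℂ → ℂ, ContinuousOn F (closedBall 0 1) ∧ EqOn F f (ball 0 1) ∧
      MapsTo F (sphere 0 1) (frontier W) := by
  have hlim : ∀ ζ ∈ closedBall (0 : ℂ) 1, ∃ w, Tendsto f (𝓝[ball 0 1] ζ) (𝓝 w) := by
    intro ζ hζ
    have hne := neBot_nhdsWithin_ball hζ
    rcases lt_or_eq_of_le (mem_closedBall_zero_iff.1 hζ) with h1 | h1
    · exact ⟨f ζ, (h.differentiableOn.continuousOn ζ (mem_ball_zero_iff.2 h1))⟩
    · have hC : Cauchy (map f (𝓝[ball 0 1] ζ)) := by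
        refine Metric.cauchy_iff.2 ⟨hne.map f, fun ε hε => ?_⟩
        obtain ⟨V, hV, p, hp⟩ := h.exists_mapsTo_closedBall hW hWc hWb hloc h1
          (ε := ε / 3) (by linarith)
        refine ⟨closedBall p (ε / 3), mem_map.2 (mem_of_superset
          (mem_nhdsWithin.2 ⟨interior V, isOpen_interior, mem_interior_iff_mem_nhds.2 hV,
            inter_subset_inter_left _ interior_subset⟩) hp), fun x hx y hy => ?_⟩
        have := dist_triangle_right x y p
        rw [mem_closedBall] at hx hy
        linarith
      exact CompleteSpace.complete hC
  have hcont : ContinuousOn (extendFrom (ball 0 1) f) (closedBall 0 1) :=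
    continuousOn_extendFrom (closure_ball (0 : ℂ) one_ne_zero).ge hlim
  refine ⟨_, hcont, fun z hz => extendFrom_eq (subset_closure hz)
    (h.differentiableOn.continuousOn z hz), fun ζ hζ => ?_⟩
  have hζ' := sphere_subset_closedBall hζ
  have hne := neBot_nhdsWithin_ball hζ'
  exact h.mem_frontier hW (l := 𝓝[ball 0 1] ζ) (u := id) (mem_sphere_zero_iff_norm.1 hζ)
    self_mem_nhdsWithin nhdsWithin_le_nhds (tendsto_extendFrom (hlim ζ hζ'))

/-- A function vanishing identically on an arc of the circle vanishes at the centre. -/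
theorem eq_of_eq_on_arc {F : ℂ → ℂ} (hF : ContinuousOn F (closedBall 0 1))
    (hd : DifferentiableOn ℂ F (ball 0 1)) {N : Set ℂ} (hN : IsOpen N) {ζ p : ℂ}
    (hζ : ‖ζ‖ = 1) (hζN : ζ ∈ N) (hp : ∀ z ∈ N, ‖z‖ = 1 → F z = p) : F 0 = p := by
  obtain ⟨t, ht, hcov⟩ := (isCompact_sphere (0 : ℂ) 1).elim_nhds_subcover
    (fun z => (fun w => ζ / z * w) ⁻¹' N) fun z hz => by
      refine (hN.preimage (by fun_prop)).mem_nhds ?_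
      rw [mem_sphere_zero_iff_norm] at hz
      have : z ≠ 0 := norm_pos_iff.1 (by rw [hz]; exact one_pos)
      change ζ / z * z ∈ N
      rwa [div_mul_cancel₀ _ this]
  have hnorm : ∀ z ∈ t, ∀ w, ‖ζ / z * w‖ = ‖w‖ := fun z hz w => by
    rw [norm_mul, norm_div, hζ, mem_sphere_zero_iff_norm.1 (ht z hz), div_one, one_mul]
  have hG : DiffContOnCl ℂ (fun w => ∏ z ∈ t, (F (ζ / z * w) - p)) (ball 0 1) := by
    constructor
    · refine DifferentiableOn.fun_finsetProd fun z hz => ?_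
      refine (hd.comp (differentiableOn_id.const_mul (ζ / z)) fun w hw => ?_).sub_const p
      rw [mem_ball_zero_iff] at hw ⊢
      exact (hnorm z hz w).trans_lt hw
    · rw [closure_ball _ one_ne_zero]
      refine continuousOn_finsetProd _ fun z hz => ?_
      refine (hF.comp (continuousOn_id.const_mul (ζ / z)) fun w hw => ?_).sub continuousOn_const
      rw [mem_closedBall_zero_iff] at hw ⊢
      exact (hnorm z hz w).trans_le hw
  have h0 := Complex.norm_le_of_forall_mem_frontier_norm_le isBounded_ball hG (C := 0)
    (fun w hw => by
      rw [frontier_ball _ one_ne_zero] at hw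
      obtain ⟨z, hz, hzw⟩ := mem_iUnion₂.1 (hcov hw)
      rw [Finset.prod_eq_zero hz, norm_zero]
      rw [hp _ hzw (by rw [hnorm z hz, mem_sphere_zero_iff_norm.1 hw]), sub_self])
    (subset_closure (mem_ball_self one_pos))
  obtain ⟨z, -, hz⟩ := Finset.prod_eq_zero_iff.1 (norm_le_zero_iff.1 h0)
  rw [mul_zero] at hz
  exact sub_eq_zero.1 hz

/-- The signed distance from `z` to the line through `a` and `b`, up to a factor. -/
def sideOf (a b z : ℂ) : ℝ := (z.im - a.im) * (b.re - a.re) - (z.re - a.re) * (b.im - a.im)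

theorem continuous_sideOf (a b : ℂ) : Continuous (sideOf a b) := by
  unfold sideOf
  fun_prop

theorem sideOf_swap (a b z : ℂ) : sideOf b a z = -sideOf a b z := by
  unfold sideOf
  ring

theorem mem_segment_of_sideOf_eq_zero {a b z : ℂ} (hab : a ≠ b) (ha : ‖a‖ = 1) (hb : ‖b‖ = 1)
    (hz : ‖z‖ ≤ 1) (h : sideOf a b z = 0) : z ∈ segment ℝ a b := by
  have ha' : a.re * a.re + a.im * a.im = 1 := by
    rw [← Complex.normSq_apply, Complex.normSq_eq_norm_sq, ha, one_pow]
  have hb' : b.re * b.re + b.im * b.im = 1 := by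
    rw [← Complex.normSq_apply, Complex.normSq_eq_norm_sq, hb, one_pow]
  have hz' : z.re * z.re + z.im * z.im ≤ 1 := by
    rw [← Complex.normSq_apply, Complex.normSq_eq_norm_sq]
    nlinarith [norm_nonneg z]
  have hD : 0 < (b.re - a.re) ^ 2 + (b.im - a.im) ^ 2 := by
    by_contra! hD
    refine hab (Complex.ext ?_ ?_) <;> nlinarith [sq_nonneg (b.re - a.re), sq_nonneg (b.im - a.im)]
  unfold sideOf at h
  set D := (b.re - a.re) ^ 2 + (b.im - a.im) ^ 2 with hDdef
  set t := ((z.re - a.re) * (b.re - a.re) + (z.im - a.im) * (b.im - a.im)) / D with ht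
  have htD : t * D = (z.re - a.re) * (b.re - a.re) + (z.im - a.im) * (b.im - a.im) := by
    rw [ht, div_mul_cancel₀ _ hD.ne']
  have h1 : z.re = a.re + t * (b.re - a.re) := by
    refine mul_right_cancel₀ hD.ne' ?_
    linear_combination (-(b.re - a.re)) * htD - (b.im - a.im) * h
  have h2 : z.im = a.im + t * (b.im - a.im) := by
    refine mul_right_cancel₀ hD.ne' ?_
    linear_combination (-(b.im - a.im)) * htD + (b.re - a.re) * h
  have h3 : 0 ≤ t * (1 - t) := by
    rw [h1, h2] at hz'
    have h4 : t * (1 - t) * D = 1 - ((a.re + t * (b.re - a.re)) * (a.re + t * (b.re - a.re)) +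
        (a.im + t * (b.im - a.im)) * (a.im + t * (b.im - a.im))) := by
      linear_combination (1 - t) * ha' + t * hb'
    have : 0 ≤ t * (1 - t) * D := by linarith
    exact nonneg_of_mul_nonneg_left this hD
  refine ⟨1 - t, t, by nlinarith, by nlinarith, by ring, Complex.ext ?_ ?_⟩
  · simp only [Complex.add_re, Complex.smul_re, smul_eq_mul]
    linarith
  · simp only [Complex.add_im, Complex.smul_im, smul_eq_mul]
    linarith

theorem exists_sideOf_pos {a b : ℂ} (hab : a ≠ b) (ha : ‖a‖ = 1) (hb : ‖b‖ = 1) :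
    ∃ z : ℂ, ‖z‖ = 1 ∧ 0 < sideOf a b z := by
  set d := b - a with hd
  have hd0 : 0 < ‖d‖ := norm_pos_iff.2 (sub_ne_zero.2 hab.symm)
  refine ⟨Complex.I * d / ‖d‖, ?_, ?_⟩
  · rw [norm_div, norm_mul, Complex.norm_I, one_mul, Complex.norm_real, norm_norm,
      div_self hd0.ne']
  have ha' : a.re * a.re + a.im * a.im = 1 := by
    rw [← Complex.normSq_apply, Complex.normSq_eq_norm_sq, ha, one_pow]
  have hb' : b.re * b.re + b.im * b.im = 1 := by
    rw [← Complex.normSq_apply, Complex.normSq_eq_norm_sq, hb, one_pow]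
  have hn : ‖d‖ * ‖d‖ = (b.re - a.re) ^ 2 + (b.im - a.im) ^ 2 := by
    rw [← sq, ← Complex.normSq_eq_norm_sq, Complex.normSq_apply, hd, Complex.sub_re,
      Complex.sub_im]
    ring
  have h1 : sideOf a b (Complex.I * d / ‖d‖) =
      ‖d‖ + (a.re * (b.im - a.im) - a.im * (b.re - a.re)) := by
    have hre : (Complex.I * d / ‖d‖).re = -(b.im - a.im) / ‖d‖ := by
      rw [Complex.div_ofReal_re]; simp [hd]
    have him : (Complex.I * d / ‖d‖).im = (b.re - a.re) / ‖d‖ := by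
      rw [Complex.div_ofReal_im]; simp [hd]
    unfold sideOf
    rw [hre, him]
    field_simp
    linear_combination -hn
  rw [h1]
  have h2 : (a.re * (b.im - a.im) - a.im * (b.re - a.re)) ^ 2 < ‖d‖ ^ 2 := by
    have hpos : 0 < ‖d‖ ^ 2 := by positivity
    have h3 : 2 * (a.re * (b.re - a.re) + a.im * (b.im - a.im)) = -‖d‖ ^ 2 := by
      linear_combination hb' - ha' + hn
    have h4 : (a.re * (b.im - a.im) - a.im * (b.re - a.re)) ^ 2 +
        (a.re * (b.re - a.re) + a.im * (b.im - a.im)) ^ 2 = ‖d‖ ^ 2 := by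
      linear_combination ((b.re - a.re) ^ 2 + (b.im - a.im) ^ 2) * ha' - hn
    nlinarith
  linarith [(abs_lt_of_sq_lt_sq' h2 hd0.le).1]

/-- If the boundary extension `F` takes the same value at `a` and `b`, then it cannot take different
values on both sides of the chord from `a` to `b`. -/
theorem IsRiemannMap.eq_of_sideOf {W U : Set ℂ} {f g F : ℂ → ℂ} (h : IsRiemannMap W f g)
    (hW : IsOpen W) (hWc : IsPreconnected W) (hWb : Bornology.IsBounded W)
    (hF : ContinuousOn F (closedBall 0 1)) (hFf : EqOn F f (ball 0 1))
    (hFs : MapsTo F (sphere 0 1) (frontier W)) (hU : IsPreconnected U)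
    (hUW : Disjoint U (closure W)) (hWU : frontier W ⊆ closure U) {a b : ℂ} (hab : a ≠ b)
    (ha : ‖a‖ = 1) (hb : ‖b‖ = 1) (hFab : F a = F b) {x y : ℂ} (hx : ‖x‖ = 1) (hy : ‖y‖ = 1)
    (hxs : 0 < sideOf a b x) (hys : sideOf a b y < 0) : F x = F a ∨ F y = F a := by
  by_contra! hne
  have hseg : segment ℝ a b ⊆ closedBall 0 1 :=
    (convex_closedBall 0 1).segment_subset (mem_closedBall_zero_iff.2 ha.le)
      (mem_closedBall_zero_iff.2 hb.le)
  set J := F '' segment ℝ a b with hJ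
  have hJcl : IsClosed J := by
    have hc : IsCompact (segment ℝ a b) := by
      rw [segment_eq_image_lineMap]
      exact isCompact_Icc.image AffineMap.lineMap_continuous
    exact (hc.image_of_continuousOn (hF.mono hseg)).isClosed
  have hfr : Disjoint W (frontier W) := by
    rw [hW.frontier_eq]
    exact disjoint_sdiff_right
  have hJW : J ∩ Wᶜ = {F a} := by
    refine subset_antisymm ?_ (singleton_subset_iff.2 ⟨mem_image_of_mem _ (left_mem_segment ℝ a b),
      disjoint_right.1 hfr (hFs (mem_sphere_zero_iff_norm.2 ha))⟩)
    rintro _ ⟨⟨z, hz, rfl⟩, hzW⟩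
    rw [← insert_endpoints_openSegment] at hz
    rcases hz with rfl | rfl | hz
    · rfl
    · exact hFab.symm
    · have hzb := openSegment_subset_ball_of_ne (mem_closedBall_zero_iff.2 ha.le)
        (mem_closedBall_zero_iff.2 hb.le) hab hz
      exact absurd (by rw [hFf hzb]; exact h.mapsTo hzb) hzW
  have hJcW : J ⊆ closure W := by
    intro w hw
    by_cases hwW : w ∈ W
    · exact subset_closure hwW
    · have : w ∈ J ∩ Wᶜ := ⟨hw, hwW⟩
      rw [hJW, mem_singleton_iff] at this
      rw [this]
      exact frontier_subset_closure (hFs (mem_sphere_zero_iff_norm.2 ha))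
  have hnear : ∀ z, ‖z‖ = 1 → F z ≠ F a → ∀ N : Set ℂ, IsOpen N → z ∈ N →
      ∃ r, 0 < r ∧ Disjoint (ball (F z) r) J ∧ (ball (F z) r ∩ U).Nonempty ∧
        ∃ w ∈ ball (0 : ℂ) 1, w ∈ N ∧ f w ∈ ball (F z) r := by
    intro z hz hza N hN hzN
    have hzs := mem_sphere_zero_iff_norm.2 hz
    have hzJ : F z ∉ J := fun hzJ => by
      have : F z ∈ J ∩ Wᶜ := ⟨hzJ, disjoint_right.1 hfr (hFs hzs)⟩
      rw [hJW] at this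
      exact hza this
    obtain ⟨r, hr, hrJ⟩ := Metric.isOpen_iff.1 hJcl.isOpen_compl _ hzJ
    refine ⟨r, hr, disjoint_left.2 hrJ, ?_, ?_⟩
    · exact mem_closure_iff.1 (hWU (hFs hzs)) _ isOpen_ball (mem_ball_self hr)
    · have hne := neBot_nhdsWithin_ball (sphere_subset_closedBall hzs)
      have h1 : ∀ᶠ w in 𝓝[ball 0 1] z, F w ∈ ball (F z) r :=
        ((hF z (sphere_subset_closedBall hzs)).mono_left (nhdsWithin_mono _ ball_subset_closedBall))
          (ball_mem_nhds _ hr)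
      have h2 : ∀ᶠ w in 𝓝[ball 0 1] z, w ∈ N := nhdsWithin_le_nhds (hN.mem_nhds hzN)
      obtain ⟨w, ⟨hw1, hw2⟩, hw3⟩ := ((h1.and h2).and self_mem_nhdsWithin).exists
      exact ⟨w, hw3, hw2, by rwa [← hFf hw3]⟩
  have hcs := continuous_sideOf a b
  obtain ⟨r, hr, hrJ, hrU, x', hx', hxs', hxr⟩ := hnear x hx hne.1 {z | 0 < sideOf a b z}
    (isOpen_lt continuous_const hcs) hxs
  obtain ⟨ρ, hρ, hρJ, hρU, y', hy', hys', hyρ⟩ := hnear y hy hne.2 {z | sideOf a b z < 0}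
    (isOpen_lt hcs continuous_const) hys
  have hO : IsPreconnected (ball (F x) r ∪ U ∪ ball (F y) ρ) := by
    obtain ⟨u, hu⟩ := hrU
    obtain ⟨v, hv⟩ := hρU
    refine IsPreconnected.union v (Or.inr hv.2) hv.1 (IsPreconnected.union u hu.1 hu.2 ?_ hU) ?_
    · exact (convex_ball _ _).isPreconnected
    · exact (convex_ball _ _).isPreconnected
  have hOJ : Disjoint (ball (F x) r ∪ U ∪ ball (F y) ρ) J :=
    ((hrJ.union_left (hUW.mono_right hJcW)).union_left hρJ)
  have hQ := mem_connectedComponentIn_union hJcl hW.isClosed_compl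
    (by rw [hJW]; exact isPreconnected_singleton)
    (hWb.subset fun x hx => by
      by_contra hxW
      exact hx (Or.inr hxW)) hO hWc hOJ disjoint_compl_right
    (a := f x') (b := f y') (Or.inl (Or.inl hxr)) (Or.inr hyρ) (h.mapsTo hx') (h.mapsTo hy')
  set Q := connectedComponentIn (J ∪ Wᶜ)ᶜ (f x') with hQdef
  have hQsub : Q ⊆ (J ∪ Wᶜ)ᶜ := connectedComponentIn_subset _ _
  have hxQ : f x' ∈ Q := mem_connectedComponentIn fun hx => by
    rcases hx with hx | hx
    · exact disjoint_left.1 hrJ hxr hx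
    · exact hx (h.mapsTo hx')
  have hQW : Q ⊆ W := fun x hx => by
    by_contra hxW
    exact hQsub hx (Or.inr hxW)
  obtain ⟨w, hwQ, hw⟩ := isPreconnected_connectedComponentIn.intermediate_value hQ hxQ
    (hcs.comp_continuousOn (h.differentiableOn_inv.continuousOn.mono hQW)) (show (0 : ℝ) ∈ _ by
      simp only [Function.comp_apply, h.leftInvOn hx', h.leftInvOn hy']
      exact ⟨le_of_lt hys', le_of_lt hxs'⟩)
  have hgw := h.mapsTo_inv (hQW hwQ)
  refine hQsub hwQ (Or.inl ⟨g w, mem_segment_of_sideOf_eq_zero hab ha hb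
    (mem_ball_zero_iff.1 hgw).le hw, ?_⟩)
  rw [hFf hgw, h.rightInvOn (hQW hwQ)]

theorem IsRiemannMap.injOn_sphere {W U : Set ℂ} {f g F : ℂ → ℂ} (h : IsRiemannMap W f g)
    (hW : IsOpen W) (hWc : IsPreconnected W) (hWb : Bornology.IsBounded W)
    (hF : ContinuousOn F (closedBall 0 1)) (hFf : EqOn F f (ball 0 1))
    (hFs : MapsTo F (sphere 0 1) (frontier W)) (hU : IsPreconnected U)
    (hUW : Disjoint U (closure W)) (hWU : frontier W ⊆ closure U) : InjOn F (sphere 0 1) := by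
  intro a ha b hb hFab
  by_contra hab
  rw [mem_sphere_zero_iff_norm] at ha hb
  have hfr : Disjoint W (frontier W) := by
    rw [hW.frontier_eq]
    exact disjoint_sdiff_right
  have harc : ∀ a b : ℂ, a ≠ b → ‖a‖ = 1 → ‖b‖ = 1 →
      ∃ y, ‖y‖ = 1 ∧ 0 < sideOf a b y ∧ F y ≠ F a := by
    intro a b hab ha hb
    by_contra! hall
    obtain ⟨ζ, hζ, hζs⟩ := exists_sideOf_pos hab ha hb
    have h0 := eq_of_eq_on_arc hF (h.differentiableOn.congr hFf)
      (isOpen_lt continuous_const (continuous_sideOf a b)) hζ hζs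
      fun z (hz : 0 < sideOf a b z) hz1 => hall z hz1 hz
    have hm : (0 : ℂ) ∈ ball (0 : ℂ) 1 := mem_ball_self one_pos
    refine disjoint_left.1 hfr (h.mapsTo hm) ?_
    rw [← hFf hm, h0]
    exact hFs (mem_sphere_zero_iff_norm.2 ha)
  obtain ⟨x, hx, hxs, hxa⟩ := harc a b hab ha hb
  obtain ⟨y, hy, hys, hya⟩ := harc b a (Ne.symm hab) hb ha
  rw [sideOf_swap] at hys
  rcases h.eq_of_sideOf hW hWc hWb hF hFf hFs hU hUW hWU hab ha hb hFab hx hy hxs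
    (neg_pos.1 hys) with h1 | h1
  · exact hxa h1
  · exact hya (h1.trans hFab)

/-- A bounded simply connected plane domain with locally connected frontier which is accessible from
a connected set in the exterior has closure homeomorphic to the closed disk. -/
theorem nonempty_closure_homeomorph {W U : Set ℂ} (hW : IsOpen W) (hne : W.Nonempty)
    (hWc : IsPreconnected W) (hWb : Bornology.IsBounded W) (hWcc : IsPreconnected Wᶜ)
    (hloc : FrontierLocallyConnected W) (hU : IsPreconnected U)
    (hUW : Disjoint U (closure W)) (hWU : frontier W ⊆ closure U) :
    Nonempty (closure W ≃ₜ closedBall (0 : ℂ) 1) := by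
  obtain ⟨f, g, hf, hg, hfm, hgm, hl, hr⟩ := exists_riemann_map hW hne hWc hWb hWcc
  have h : IsRiemannMap W f g := ⟨hf, hg, hfm, hgm, hl, hr⟩
  obtain ⟨F, hF, hFf, hFs⟩ := h.exists_extension hW hWc hWb hloc
  have hs := h.injOn_sphere hW hWc hWb hF hFf hFs hU hUW hWU
  have hfr : Disjoint W (frontier W) := by
    rw [hW.frontier_eq]
    exact disjoint_sdiff_right
  have hFb : MapsTo F (ball 0 1) W := fun z hz => by rw [hFf hz]; exact h.mapsTo hz
  have hinj : InjOn F (closedBall 0 1) := by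
    rw [← ball_union_sphere, injOn_union (disjoint_left.2 fun z hz hz' =>
      (mem_ball.1 hz).ne (mem_sphere.1 hz'))]
    refine ⟨hFf.injOn_iff.2 h.leftInvOn.injOn, hs, fun z hz w hw hzw => ?_⟩
    exact disjoint_left.1 hfr (hFb hz) (hzw ▸ hFs hw)
  have himg : F '' closedBall 0 1 = closure W := by
    refine subset_antisymm ?_ (closure_minimal (fun w hw => ⟨g w,
      ball_subset_closedBall (h.mapsTo_inv hw), ?_⟩)
      ((isCompact_closedBall 0 1).image_of_continuousOn hF).isClosed)
    · rw [← ball_union_sphere, image_union, union_subset_iff]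
      exact ⟨hFb.image_subset.trans subset_closure,
        hFs.image_subset.trans frontier_subset_closure⟩
    · rw [hFf (h.mapsTo_inv hw), h.rightInvOn hw]
  rw [← himg]
  have hK : CompactSpace (closedBall (0 : ℂ) 1) :=
    isCompact_iff_compactSpace.1 (isCompact_closedBall 0 1)
  refine ⟨(Continuous.homeoOfEquivCompactToT2 (f := Equiv.Set.imageOfInjOn F _ hinj) ?_).symm⟩
  exact hF.domRestrict.subtype_mk _

/-! ### Surfaces and the sphere -/

theorem isPreconnected_ball_diff_singleton (c : ℂ) (r : ℝ) : IsPreconnected (ball c r \ {c}) := by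
  have himg : (fun q : ℝ × ℝ => c + q.1 * Complex.exp (q.2 * Complex.I)) '' (Ioo 0 r ×ˢ univ) =
      ball c r \ {c} := by
    ext z
    simp only [mem_image, mem_prod, mem_univ, and_true, Set.mem_sdiff, mem_ball, mem_singleton_iff,
      Prod.exists, dist_eq_norm]
    constructor
    · rintro ⟨ρ, θ, h, rfl⟩
      rw [add_sub_cancel_left, norm_mul, Complex.norm_exp_ofReal_mul_I, mul_one, Complex.norm_real,
        Real.norm_eq_abs, abs_of_pos h.1, add_eq_left]
      exact ⟨h.2, mul_ne_zero (Complex.ofReal_ne_zero.2 h.1.ne') (Complex.exp_ne_zero _)⟩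
    · intro h
      exact ⟨‖z - c‖, Complex.arg (z - c), ⟨norm_pos_iff.2 (sub_ne_zero.2 h.2), h.1⟩,
        by rw [Complex.norm_mul_exp_arg_mul_I]; ring⟩
  rw [← himg]
  exact ((convex_Ioo 0 r).prod convex_univ).isPreconnected.image _ (by fun_prop)

variable {X : Type*} [TopologicalSpace X]

/-- Removing an interior point from a connected subset of a surface does not disconnect it. -/
theorem isPreconnected_diff_singleton [T1Space X] (e : OpenPartialHomeomorph X ℂ) {T : Set X}
    {p : X} (hpe : p ∈ e.source) (hT : IsPreconnected T) (hp : p ∈ interior T) :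
    IsPreconnected (T \ {p}) := by
  obtain ⟨D, hDo, hpD, hDT, hD⟩ : ∃ D, IsOpen D ∧ p ∈ D ∧ D ⊆ T ∧ IsPreconnected (D \ {p}) := by
    have ho : IsOpen (e '' (e.source ∩ interior T)) := e.isOpen_image_source_inter isOpen_interior
    obtain ⟨r, hr, hrT⟩ := Metric.isOpen_iff.1 ho (e p) (mem_image_of_mem _ ⟨hpe, hp⟩)
    have ht : ball (e p) r ⊆ e.target := fun z hz => by
      obtain ⟨y, hy, rfl⟩ := hrT hz
      exact e.map_source hy.1
    refine ⟨e.symm '' ball (e p) r, e.isOpen_image_symm_of_subset_target isOpen_ball ht,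
      ⟨e p, mem_ball_self hr, e.left_inv hpe⟩, ?_, ?_⟩
    · rintro _ ⟨z, hz, rfl⟩
      obtain ⟨y, hy, rfl⟩ := hrT hz
      rw [e.left_inv hy.1]
      exact interior_subset hy.2
    · have : e.symm '' ball (e p) r \ {p} = e.symm '' (ball (e p) r \ {e p}) := by
        rw [(e.symm.injOn.mono ht).image_sdiff_subset (singleton_subset_iff.2 (mem_ball_self hr)),
          image_singleton, e.left_inv hpe]
      rw [this]
      exact (isPreconnected_ball_diff_singleton _ _).image _
        (e.symm.continuousOn.mono (sdiff_subset.trans ht))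
  rw [isPreconnected_iff_subset_of_disjoint] at hT hD ⊢
  have key : ∀ A B : Set X, IsOpen A → IsOpen B → T \ {p} ⊆ A ∪ B → T \ {p} ∩ (A ∩ B) = ∅ →
      D \ {p} ⊆ A → T \ {p} ⊆ A := by
    intro A B hA hB hcov hdisj hDA
    have := hT (A ∪ D) (B \ {p}) (hA.union hDo) (hB.sdiff isClosed_singleton) ?_ ?_
    · rcases this with h | h
      · intro x hx
        exact (h hx.1).elim id fun hxD => hDA ⟨hxD, hx.2⟩
      · exact absurd rfl (h (hDT hpD)).2
    · intro x hx
      by_cases hxp : x = p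
      · exact Or.inl (Or.inr (hxp ▸ hpD))
      · exact (hcov ⟨hx, hxp⟩).elim (fun h => Or.inl (Or.inl h)) fun h => Or.inr ⟨h, hxp⟩
    · refine eq_empty_iff_forall_notMem.2 fun x ⟨hxT, hx, hxB, hxp⟩ => ?_
      refine eq_empty_iff_forall_notMem.1 hdisj x ⟨⟨hxT, hxp⟩, ?_, hxB⟩
      exact hx.elim id fun hxD => hDA ⟨hxD, hxp⟩
  intro A B hA hB hcov hdisj
  have hDT' : D \ {p} ⊆ T \ {p} := sdiff_subset_sdiff_left hDT
  rcases hD A B hA hB (hDT'.trans hcov)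
    (subset_empty_iff.1 (hdisj ▸ inter_subset_inter_left _ hDT')) with h | h
  · exact Or.inl (key A B hA hB hcov hdisj h)
  · exact Or.inr (key B A hB hA (union_comm A B ▸ hcov) (inter_comm A B ▸ hdisj) h)

/-- An embedded closed disk in a surface is the closure of its interior. -/
theorem mem_closure_interior_of_homeomorph (e : OpenPartialHomeomorph X ℂ) {V : Set X}
    (h : V ≃ₜ closedBall (0 : ℂ) 1) {x : X} (hx : x ∈ V) (hxe : x ∈ e.source) :
    x ∈ closure (interior V) := by
  rw [_root_.mem_closure_iff]
  intro o ho hxo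
  have hS : IsOpen ((fun z => (h.symm z : X)) ⁻¹' (o ∩ e.source)) :=
    (ho.inter e.open_source).preimage (continuous_subtype_val.comp h.symm.continuous)
  obtain ⟨G, hG, hGS⟩ := isOpen_induced_iff.1 hS
  have hxG : (h ⟨x, hx⟩ : ℂ) ∈ G := by
    change h ⟨x, hx⟩ ∈ Subtype.val ⁻¹' G
    rw [hGS]
    simpa using ⟨hxo, hxe⟩
  have hcl : (h ⟨x, hx⟩ : ℂ) ∈ closure (ball (0 : ℂ) 1) := by
    rw [closure_ball _ one_ne_zero]
    exact (h ⟨x, hx⟩).2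
  obtain ⟨c, hc⟩ := _root_.mem_closure_iff.1 hcl G hG hxG
  obtain ⟨r, hr, hrG⟩ := Metric.nhds_basis_closedBall.mem_iff.1 ((hG.inter isOpen_ball).mem_nhds hc)
  have hsub : closedBall c r ⊆ closedBall 0 1 := fun z hz => ball_subset_closedBall (hrG hz).2
  have hmem : ∀ z (hz : z ∈ closedBall c r), (h.symm ⟨z, hsub hz⟩ : X) ∈ o ∩ e.source :=
    fun z hz => by
      have : (⟨z, hsub hz⟩ : closedBall (0 : ℂ) 1) ∈ Subtype.val ⁻¹' G := (hrG hz).1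
      rw [hGS] at this
      exact this
  classical
  let φ : ℂ → ℂ := fun z => if hz : z ∈ closedBall 0 1 then e (h.symm ⟨z, hz⟩) else 0
  have hφ : ∀ z (hz : z ∈ closedBall c r), φ z = e (h.symm ⟨z, hsub hz⟩) := fun z hz =>
    dif_pos (hsub hz)
  have hφc : ContinuousOn φ (closedBall c r) := by
    rw [continuousOn_iff_continuous_domRestrict]
    have : Continuous fun z : closedBall c r => e (h.symm ⟨z, hsub z.2⟩) :=
      e.continuousOn.comp_continuous (continuous_subtype_val.comp (h.symm.continuous.comp
        (continuous_subtype_val.subtype_mk _))) fun z => (hmem z z.2).2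
    exact this.congr fun z => (hφ z z.2).symm
  have hφi : InjOn φ (closedBall c r) := by
    intro z hz w hw hzw
    rw [hφ z hz, hφ w hw] at hzw
    have := h.symm.injective (Subtype.ext (e.injOn (hmem z hz).2 (hmem w hw).2 hzw))
    exact congrArg Subtype.val this
  obtain ⟨w, hw⟩ := interior_image_closedBall_nonempty hr hφc hφi
  set I := interior (φ '' closedBall c r)
  have hI : ∀ y ∈ I, ∃ v ∈ V ∩ (o ∩ e.source), e v = y := by
    intro y hy
    obtain ⟨z, hz, rfl⟩ := interior_subset hy
    exact ⟨_, ⟨(h.symm ⟨z, hsub hz⟩).2, hmem z hz⟩, (hφ z hz).symm⟩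
  have hIo : IsOpen (e.symm '' I) :=
    e.isOpen_image_symm_of_subset_target isOpen_interior fun y hy => by
      obtain ⟨v, hv, rfl⟩ := hI y hy
      exact e.map_source hv.2.2
  have hIV : e.symm '' I ⊆ V ∩ o := by
    rintro _ ⟨y, hy, rfl⟩
    obtain ⟨v, hv, rfl⟩ := hI y hy
    rw [e.left_inv hv.2.2]
    exact ⟨hv.1, hv.2.1⟩
  exact ⟨e.symm w, (hIV (mem_image_of_mem _ hw)).2,
    interior_maximal (hIV.trans inter_subset_left) hIo (mem_image_of_mem _ hw)⟩

theorem frontier_connectedComponentIn_compl_subset [LocallyConnectedSpace X] {K : Set X}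
    (hK : IsClosed K) (x : X) : frontier (connectedComponentIn Kᶜ x) ⊆ K := by
  have hopen : ∀ y, IsOpen (connectedComponentIn Kᶜ y) := fun y =>
    hK.isOpen_compl.connectedComponentIn
  intro z hz
  rw [(hopen x).frontier_eq] at hz
  by_contra hzK
  obtain ⟨w, hwz, hwx⟩ := _root_.mem_closure_iff.1 hz.1 _ (hopen z) (mem_connectedComponentIn hzK)
  refine hz.2 ?_
  rw [connectedComponentIn_eq hwx, ← connectedComponentIn_eq hwz]
  exact mem_connectedComponentIn hzK

/-- If `K` is closed and connected then the complement of each component of `Kᶜ` is connected. -/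
theorem isPreconnected_compl_connectedComponentIn [PreconnectedSpace X] [LocallyConnectedSpace X]
    {K : Set X} (hK : IsClosed K) (hKc : IsPreconnected K) (hne : K.Nonempty) (x : X) :
    IsPreconnected (connectedComponentIn Kᶜ x)ᶜ := by
  have hopen : ∀ y, IsOpen (connectedComponentIn Kᶜ y) := fun y =>
    hK.isOpen_compl.connectedComponentIn
  have hKW : K ⊆ (connectedComponentIn Kᶜ x)ᶜ := fun y hy hy' =>
    connectedComponentIn_subset _ _ hy' hy
  obtain ⟨k, hk⟩ := hne
  have hmeet : ∀ y, y ∈ Kᶜ → (closure (connectedComponentIn Kᶜ y) ∩ K).Nonempty := by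
    intro y hy
    have hfr : (frontier (connectedComponentIn Kᶜ y)).Nonempty :=
      nonempty_frontier_iff.2 ⟨⟨y, mem_connectedComponentIn hy⟩, fun huniv =>
        connectedComponentIn_subset Kᶜ y (huniv ▸ mem_univ k) hk⟩
    exact hfr.mono (subset_inter frontier_subset_closure
      (frontier_connectedComponentIn_compl_subset hK y))
  refine isPreconnected_of_forall k fun y hy => ?_
  by_cases hyK : y ∈ K
  · exact ⟨K, hKW, hk, hyK, hKc⟩
  · obtain ⟨m, hm, hmK⟩ := hmeet y hyK
    refine ⟨closure (connectedComponentIn Kᶜ y) ∪ K, union_subset ?_ hKW, Or.inr hk,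
      Or.inl (subset_closure (mem_connectedComponentIn hyK)),
      isPreconnected_connectedComponentIn.closure.union m hm hmK hKc⟩
    refine closure_minimal (fun z hzy hzx => hy ?_) (hopen x).isClosed_compl
    rw [connectedComponentIn_eq hzx, ← connectedComponentIn_eq hzy]
    exact mem_connectedComponentIn hyK

theorem eventually_exists_isPreconnected_of_homeomorph {V : Set X}
    (h : V ≃ₜ closedBall (0 : ℂ) 1) {x : X} (hx : x ∈ V) {N : Set X} (hN : N ∈ 𝓝 x) :
    ∀ᶠ y in 𝓝 x, y ∈ V → ∃ B ⊆ V ∩ N, IsCompact B ∧ IsPreconnected B ∧ x ∈ B ∧ y ∈ B := by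
  have hc : Continuous fun z => (h.symm z : X) := continuous_subtype_val.comp h.symm.continuous
  have hNx : (fun z => (h.symm z : X)) ⁻¹' N ∈ 𝓝 (h ⟨x, hx⟩) :=
    hc.continuousAt.preimage_mem_nhds (by simpa using hN)
  obtain ⟨r, hr, hrN⟩ := Metric.nhds_basis_closedBall.mem_iff.1 hNx
  have hpre : h ⁻¹' closedBall (h ⟨x, hx⟩) r ∈ 𝓝 (⟨x, hx⟩ : V) :=
    h.continuous.continuousAt.preimage_mem_nhds (closedBall_mem_nhds _ hr)
  obtain ⟨u, hu, huV⟩ := (mem_nhds_subtype _ _ _).1 hpre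
  have hcomp : CompactSpace (closedBall (0 : ℂ) 1) :=
    isCompact_iff_compactSpace.1 (isCompact_closedBall 0 1)
  have hconn : IsPreconnected (closedBall (h ⟨x, hx⟩) r) := by
    rw [← IsInducing.subtypeVal.isPreconnected_image]
    have : Subtype.val '' closedBall (h ⟨x, hx⟩) r =
        closedBall (0 : ℂ) 1 ∩ closedBall (h ⟨x, hx⟩ : ℂ) r := by
      rw [← Subtype.image_preimage_coe]
      rfl
    rw [this]
    exact ((convex_closedBall _ _).inter (convex_closedBall _ _)).isPreconnected
  filter_upwards [hu] with y hy hyV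
  refine ⟨(fun z => (h.symm z : X)) '' closedBall (h ⟨x, hx⟩) r, ?_,
    isClosed_closedBall.isCompact.image hc, hconn.image _ hc.continuousOn,
    ⟨h ⟨x, hx⟩, mem_closedBall_self hr.le, by simp⟩,
    ⟨h ⟨y, hyV⟩, huV (show (⟨y, hyV⟩ : V) ∈ Subtype.val ⁻¹' u from hy), by simp⟩⟩
  rintro _ ⟨z, hz, rfl⟩
  exact ⟨(h.symm z).2, hrN hz⟩

theorem eventually_exists_isPreconnected_iUnion {ι : Type*} [Finite ι] {V : ι → Set X}
    (hV : ∀ i, IsClosed (V i)) (h : ∀ i, Nonempty (V i ≃ₜ closedBall (0 : ℂ) 1)) {x : X} {N : Set X}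
    (hN : N ∈ 𝓝 x) : ∀ᶠ y in 𝓝 x, y ∈ ⋃ i, V i →
      ∃ B ⊆ (⋃ i, V i) ∩ N, IsCompact B ∧ IsPreconnected B ∧ x ∈ B ∧ y ∈ B := by
  have : ∀ i, ∀ᶠ y in 𝓝 x, y ∈ V i →
      ∃ B ⊆ V i ∩ N, IsCompact B ∧ IsPreconnected B ∧ x ∈ B ∧ y ∈ B := by
    intro i
    by_cases hx : x ∈ V i
    · exact eventually_exists_isPreconnected_of_homeomorph (h i).some hx hN
    · filter_upwards [(hV i).isOpen_compl.mem_nhds hx] with y hy hyV using absurd hyV hy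
  filter_upwards [eventually_all.2 this] with y hy hyV
  obtain ⟨i, hi⟩ := mem_iUnion.1 hyV
  obtain ⟨B, hB, hB'⟩ := hy i hi
  exact ⟨B, hB.trans (inter_subset_inter_left _ (subset_iUnion V i)), hB'⟩

theorem frontierLocallyConnected_of_eventually {W : Set ℂ} (hWb : Bornology.IsBounded W)
    (h : ∀ x ∈ frontier W, ∀ ε > 0, ∀ᶠ y in 𝓝 x, y ∈ frontier W →
      ∃ B ⊆ Wᶜ ∩ closedBall x ε, IsClosed B ∧ IsPreconnected B ∧ x ∈ B ∧ y ∈ B) :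
    FrontierLocallyConnected W := by
  intro ε hε
  have hη : ∀ x : frontier W, ∃ η > 0, η ≤ ε / 2 ∧ ∀ y ∈ ball (x : ℂ) η, y ∈ frontier W →
      ∃ B ⊆ Wᶜ ∩ closedBall x (ε / 2), IsClosed B ∧ IsPreconnected B ∧ (x : ℂ) ∈ B ∧ y ∈ B := by
    rintro ⟨x, hx⟩
    obtain ⟨η, hη, hηs⟩ := Metric.eventually_nhds_iff_ball.1 (h x hx (ε / 2) (half_pos hε))
    exact ⟨min η (ε / 2), lt_min hη (half_pos hε), min_le_right _ _,
      fun y hy => hηs y (ball_subset_ball (min_le_left _ _) hy)⟩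
  choose η hη0 hηε hη using hη
  have hcpt : IsCompact (frontier W) :=
    Metric.isCompact_of_isClosed_isBounded isClosed_frontier
      (hWb.closure.subset frontier_subset_closure)
  obtain ⟨δ, hδ, hcov⟩ := lebesgue_number_lemma_of_metric hcpt
    (c := fun x : frontier W => ball (x : ℂ) (η x)) (fun _ => isOpen_ball)
    fun x hx => mem_iUnion.2 ⟨⟨x, hx⟩, mem_ball_self (hη0 _)⟩
  refine ⟨δ, hδ, fun x hx y hy hxy => ?_⟩
  obtain ⟨z, hz⟩ := hcov x hx
  have hxz := hz (mem_ball_self hδ)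
  have hyz := hz (mem_ball'.2 hxy)
  obtain ⟨B, hB, hBcl, hBc, hzB, hxB⟩ := hη z x hxz hx
  obtain ⟨C, hC, hCcl, hCc, hzC, hyC⟩ := hη z y hyz hy
  refine ⟨B ∪ C, union_subset (hB.trans inter_subset_left) (hC.trans inter_subset_left),
    hBcl.union hCcl, hBc.union _ hzB hzC hCc, Or.inl hxB, Or.inr hyC, ?_⟩
  refine (union_subset (hB.trans inter_subset_right) (hC.trans inter_subset_right)).trans
    (closedBall_subset_closedBall' ?_)
  have := (mem_ball'.1 hxz).le.trans (hηε z)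
  linarith

theorem nonempty_closure_homeomorph_of_chart [CompactSpace X] [T2Space X]
    {e e' : OpenPartialHomeomorph X ℂ} {p : X} (hes : e.source = {p}ᶜ) (het : e.target = univ)
    (hp : p ∈ e'.source) {K U W : Set X} (hW : IsOpen W) (hne : W.Nonempty)
    (hWc : IsPreconnected W) (hWcc : IsPreconnected Wᶜ) (hU : IsOpen U) (hUc : IsPreconnected U)
    (hpU : p ∈ U) (hUW : Disjoint U W) (hWU : frontier W ⊆ closure U) (hWK : frontier W ⊆ K)
    (hKW : Disjoint K W)
    (hloc : ∀ x ∈ K, ∀ N ∈ 𝓝 x, ∀ᶠ y in 𝓝 x, y ∈ K →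
      ∃ B ⊆ K ∩ N, IsCompact B ∧ IsPreconnected B ∧ x ∈ B ∧ y ∈ B) :
    Nonempty (closure W ≃ₜ closedBall (0 : ℂ) 1) := by
  have hUcl : Disjoint U (closure W) := hUW.closure_right hU
  have hcl : closure W ⊆ e.source := by
    rw [hes]
    exact fun x hx hxp => disjoint_left.1 hUcl hpU (mem_singleton_iff.1 hxp ▸ hx)
  have hcpt : IsCompact (closure W) := isClosed_closure.isCompact
  have hecl : ContinuousOn e (closure W) := e.continuousOn.mono hcl
  have hcl' : closure (e '' W) = e '' closure W :=
    subset_antisymm (closure_minimal (image_mono subset_closure)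
      (hcpt.image_of_continuousOn hecl).isClosed) hecl.image_closure
  have hWo : IsOpen (e '' W) :=
    e.isOpen_image_of_subset_source hW (subset_closure.trans hcl)
  have hfr' : frontier (e '' W) = e '' frontier W := by
    rw [hWo.frontier_eq, hW.frontier_eq, hcl',
      (e.injOn.mono hcl).image_sdiff_subset subset_closure]
  have hcompl : (e '' W)ᶜ = e '' (Wᶜ \ {p}) := by
    have h1 : Wᶜ \ {p} = e.source \ W := by rw [hes, sdiff_eq, sdiff_eq, inter_comm]
    rw [h1, e.injOn.image_sdiff_subset (subset_closure.trans hcl), e.image_source_eq_target, het,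
      compl_eq_univ_sdiff]
  have hWb : Bornology.IsBounded (e '' W) :=
    (hcpt.image_of_continuousOn hecl).isBounded.subset (image_mono subset_closure)
  have hdiff : ∀ T : Set X, T \ {p} ⊆ e.source := fun T => by
    rw [hes]
    exact fun x hx => hx.2
  have himg : Nonempty (closure (e '' W) ≃ₜ closedBall (0 : ℂ) 1) := by
    refine nonempty_closure_homeomorph (U := e '' (U \ {p})) hWo (hne.image e)
      (hWc.image e (hecl.mono subset_closure)) hWb ?_ ?_ ?_ ?_ ?_
    · rw [hcompl]
      exact (isPreconnected_diff_singleton e' hp hWcc (interior_maximal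
        (subset_compl_iff_disjoint_right.2 hUW) hU hpU)).image e (e.continuousOn.mono (hdiff _))
    · refine frontierLocallyConnected_of_eventually hWb ?_
      rw [hfr']
      rintro _ ⟨x, hx, rfl⟩ ε hε
      have hxs := hcl (frontier_subset_closure hx)
      have hN : {p}ᶜ ∩ e ⁻¹' closedBall (e x) ε ∈ 𝓝 x :=
        inter_mem (by rw [← hes]; exact e.open_source.mem_nhds hxs)
          ((e.continuousAt hxs).preimage_mem_nhds (closedBall_mem_nhds _ hε))
      have hev := (e.tendsto_symm hxs).eventually (hloc x (hWK hx) _ hN)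
      filter_upwards [hev] with y' hy hy'
      obtain ⟨y, hyW, rfl⟩ := hy'
      rw [e.left_inv (hcl (frontier_subset_closure hyW))] at hy
      obtain ⟨B, hB, hBc, hBp, hxB, hyB⟩ := hy (hWK hyW)
      have hBs : B ⊆ e.source := fun z hz => hes ▸ (hB hz).2.1
      refine ⟨e '' B, subset_inter ?_ ?_,
        (hBc.image_of_continuousOn (e.continuousOn.mono hBs)).isClosed,
        hBp.image e (e.continuousOn.mono hBs), mem_image_of_mem e hxB, mem_image_of_mem e hyB⟩
      · rw [hcompl]
        exact image_mono fun z hz => ⟨disjoint_left.1 hKW (hB hz).1, (hB hz).2.1⟩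
      · exact image_subset_iff.2 fun z hz => (hB hz).2.2
    · exact (isPreconnected_diff_singleton e' hp hUc (by rwa [hU.interior_eq])).image e
        (e.continuousOn.mono (hdiff _))
    · rw [hcl']
      refine disjoint_left.2 ?_
      rintro _ ⟨u, hu, rfl⟩ ⟨w, hw, hwu⟩
      rw [e.injOn (hcl hw) (hdiff U hu) hwu] at hw
      exact disjoint_left.1 hUcl hu.1 hw
    · rw [hfr']
      rintro _ ⟨x, hx, rfl⟩
      have hxs := hcl (frontier_subset_closure hx)
      have hxU : x ∈ closure (U \ {p}) := by
        have hxp : x ∈ ({p}ᶜ : Set X) := hes ▸ hxs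
        rw [sdiff_eq, inter_comm]
        exact isOpen_compl_singleton.inter_closure ⟨hxp, hWU hx⟩
      exact (e.continuousAt hxs).continuousWithinAt.mem_closure_image hxU
  obtain ⟨Φ⟩ := himg
  rw [hcl'] at Φ
  have hK : CompactSpace (closure W) := isCompact_iff_compactSpace.1 hcpt
  have Ψ : closure W ≃ₜ e '' closure W :=
    Continuous.homeoOfEquivCompactToT2 (f := Equiv.Set.imageOfInjOn e _ (e.injOn.mono hcl))
      (hecl.domRestrict.subtype_mk _)
  exact ⟨Ψ.trans Φ⟩

theorem nonempty_closedBall_homeomorph :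
    Nonempty (closedBall (0 : ℂ) 1 ≃ₜ closedBall (0 : Plane) 1) := by
  refine ⟨Complex.orthonormalBasisOneI.repr.toHomeomorph.subtype fun z => ?_⟩
  simp

theorem exists_openPartialHomeomorph_sphere
    (q : Sph) :
    ∃ e : OpenPartialHomeomorph (Sph) ℂ,
      e.source = {q}ᶜ ∧ e.target = univ := by
  have : Fact (Module.finrank ℝ (EuclideanSpace ℝ (Fin 3)) = 2 + 1) := ⟨by simp⟩
  refine ⟨(stereographic' 2 q).transHomeomorph
    Complex.orthonormalBasisOneI.repr.symm.toHomeomorph, ?_, ?_⟩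
  · simp
  · simp

end PlaneTopology

open PlaneTopology

theorem stmt_1 (n : ℕ) (V : Fin n → Set Sph)
    (hclosed : ∀ i, IsClosed (V i))
    (hdisk : ∀ i, Nonempty ((V i) ≃ₜ (closedBall (0 : Plane) 1)))
    (hconn : IsConnected (⋃ i, interior (V i)))
    (hne : ((⋃ i, V i)ᶜ : Set Sph).Nonempty)
    (W : Set Sph)
    (hWcomp : ∃ x ∈ (⋃ i, V i)ᶜ, W = connectedComponentIn (⋃ i, V i)ᶜ x) :
    Nonempty ((closure W : Set Sph) ≃ₜ (closedBall (0 : Plane) 1)) := by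
  obtain ⟨Φ⟩ := nonempty_closedBall_homeomorph
  have hdisk' : ∀ i, Nonempty (V i ≃ₜ closedBall (0 : ℂ) 1) := fun i =>
    (hdisk i).map fun h => h.trans Φ.symm
  have : Fact (Module.finrank ℝ (EuclideanSpace ℝ (Fin 3)) = 2 + 1) := ⟨by simp⟩
  have : LocallyConnectedSpace Sph :=
    ChartedSpace.locallyConnectedSpace (EuclideanSpace ℝ (Fin 2)) _
  have : PreconnectedSpace Sph := isPreconnected_iff_preconnectedSpace.1
    (isPreconnected_sphere
      (by rw [← Module.finrank_eq_rank, finrank_euclideanSpace_fin]; norm_num) 0 1)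
  have hchart : ∀ x : Sph, ∃ e : OpenPartialHomeomorph Sph ℂ, x ∈ e.source := by
    intro x
    obtain ⟨e, he, -⟩ := exists_openPartialHomeomorph_sphere (-x)
    refine ⟨e, ?_⟩
    rw [he]
    exact ne_neg_of_mem_unit_sphere ℝ x
  set K := ⋃ i, V i with hKdef
  set U := ⋃ i, interior (V i) with hUdef
  have hK : IsClosed K := isClosed_iUnion_of_finite hclosed
  have hU : IsOpen U := isOpen_iUnion fun i => isOpen_interior
  have hUK : U ⊆ K := iUnion_mono fun i => interior_subset
  have hKU : K ⊆ closure U := iUnion_subset fun i x hx => by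
    obtain ⟨e, he⟩ := hchart x
    exact closure_mono (subset_iUnion (fun i => interior (V i)) i)
      (mem_closure_interior_of_homeomorph e (hdisk' i).some hx he)
  obtain ⟨x, hx, rfl⟩ := hWcomp
  obtain ⟨p, hp⟩ := hconn.nonempty
  obtain ⟨e, hes, het⟩ := exists_openPartialHomeomorph_sphere p
  obtain ⟨e', he'⟩ := hchart p
  have hfr := frontier_connectedComponentIn_compl_subset hK x
  have hKW : Disjoint K (connectedComponentIn Kᶜ x) :=
    disjoint_compl_right.mono_right (connectedComponentIn_subset _ _)
  exact (nonempty_closure_homeomorph_of_chart hes het he' hK.isOpen_compl.connectedComponentIn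
    ⟨x, mem_connectedComponentIn hx⟩ isPreconnected_connectedComponentIn
    (isPreconnected_compl_connectedComponentIn hK
      (hconn.isPreconnected.subset_closure hUK hKU) ⟨p, hUK hp⟩ x)
    hU hconn.isPreconnected hp (hKW.mono_left hUK) (hfr.trans hKU) hfr hKW
    fun y _ N hN => eventually_exists_isPreconnected_iUnion hclosed hdisk' hN).map
      fun h => h.trans Φ
end

section
/- Let U ⊆ ℝ² be an open connected set, z ∈ ∂U a point accessible from U, and α : [0,1] → ℝ² a continuous injective map with α(0) = z and α((0,1]) ⊆ U. Then U \ α([0,1]) is connected. -/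
open Metric Set

open Filter Topology

/-- A nowhere vanishing continuous function on a simply connected space has a continuous
logarithm. -/
theorem exists_continuous_log {X : Type*} [TopologicalSpace X] [SimplyConnectedSpace X]
    [LocallyPathConnectedSpace X] (f : C(X, ℂ)) (hf : ∀ x, f x ≠ 0) :
    ∃ L : C(X, ℂ), ∀ x, Complex.exp (L x) = f x := by
  obtain ⟨x₀⟩ : Nonempty X := inferInstance
  let u : C(X, Circle) := ⟨fun x ↦ ⟨f x / ‖f x‖, mem_sphere_zero_iff_norm.2 (by
    simp [hf x])⟩, by
    refine Continuous.subtype_mk (f.continuous.div (by fun_prop) fun x ↦ ?_) _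
    simpa using hf x⟩
  obtain ⟨θ, ⟨-, hθ⟩, -⟩ :=
    Circle.isCoveringMap_exp.existsUnique_continuousMap_lifts u x₀ _ (Circle.exp_arg (u x₀))
  refine ⟨⟨fun x ↦ (Real.log ‖f x‖ : ℂ) + θ x * Complex.I, ?_⟩, fun x ↦ ?_⟩
  · have : Continuous fun x ↦ Real.log ‖f x‖ :=
      (by fun_prop : Continuous fun x ↦ ‖f x‖).log fun x ↦ by simpa using hf x
    fun_prop
  · have h : Complex.exp (θ x * Complex.I) = f x / ‖f x‖ := by
      rw [← Circle.coe_exp]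
      exact congrArg Subtype.val (congrFun hθ x)
    have h0 : (‖f x‖ : ℂ) ≠ 0 := by simpa using hf x
    simp only [ContinuousMap.coe_mk]
    rw [Complex.exp_add, h, ← Complex.ofReal_exp, Real.exp_log (by simpa using hf x)]
    field_simp

/-- A continuous function on the plane that agrees with a nonconstant affine map near infinity
has a zero. -/
theorem exists_zero_of_eq_affine (g : C(ℂ, ℂ)) {a : ℂ} (ha : a ≠ 0) {R : ℝ}
    (hg : ∀ y, R < ‖y‖ → g y = 1 - a * y) : ∃ y, g y = 0 := by
  by_contra! h
  obtain ⟨L, hL⟩ := exists_continuous_log g h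
  obtain ⟨S, hS, hSpos⟩ : ∃ S : ℝ, R + ‖a⁻¹‖ < S ∧ 0 < S :=
    ⟨max (R + ‖a⁻¹‖) 0 + 1, by linarith [le_max_left (R + ‖a⁻¹‖) 0],
      by linarith [le_max_right (R + ‖a⁻¹‖) 0]⟩
  let c : ℝ → ℂ := fun θ ↦ a⁻¹ + S * Complex.exp (θ * Complex.I)
  have hc : Continuous c := by fun_prop
  have hgc (θ : ℝ) : Complex.exp (L (c θ)) = -a * S * Complex.exp (θ * Complex.I) := by
    rw [hL, hg]
    · simp only [c]
      field_simp
      ring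
    · have h1 : ‖(S : ℂ) * Complex.exp (θ * Complex.I)‖ = S := by
        simp [Complex.norm_exp_ofReal_mul_I, abs_of_pos hSpos]
      have h2 := norm_sub_norm_le ((S : ℂ) * Complex.exp (θ * Complex.I)) (-a⁻¹)
      rw [sub_neg_eq_add, add_comm _ a⁻¹, norm_neg, h1] at h2
      linarith
  have key : (fun θ ↦ (L (c θ)).im) = fun θ ↦ θ + (L (c 0)).im := by
    refine Circle.isCoveringMap_exp.eq_of_comp_eq (by fun_prop) (by fun_prop) ?_ 0 (by simp)
    funext θ
    have h1 : Complex.exp (L (c θ)) = Complex.exp (θ * Complex.I + L (c 0)) := by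
      rw [Complex.exp_add, hgc, hgc]
      simp [mul_comm]
    obtain ⟨n, hn⟩ := Complex.exp_eq_exp_iff_exists_int.1 h1
    refine Circle.exp_eq_exp.2 ⟨n, ?_⟩
    simp [hn]
  have h1 := congrFun key (2 * Real.pi)
  have h2 : c (2 * Real.pi) = c 0 := by simp [c]
  simp only [h2] at h1
  linarith [Real.pi_pos]

/-- On `K`, the function `x ↦ (x - p) / (x - q)` has a continuous logarithm that vanishes at
infinity. -/
def HasLogQuotient (K : Set ℂ) (p q : ℂ) : Prop :=
  ∃ L : ℂ → ℂ, ContinuousOn L K ∧ (∀ x ∈ K, Complex.exp (L x) * (x - q) = x - p) ∧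
    Tendsto L (cocompact ℂ ⊓ 𝓟 K) (𝓝 0)

theorem HasLogQuotient.trans {K : Set ℂ} {p q r : ℂ} (h₁ : HasLogQuotient K p q)
    (h₂ : HasLogQuotient K q r) : HasLogQuotient K p r := by
  obtain ⟨L₁, hc₁, he₁, ht₁⟩ := h₁
  obtain ⟨L₂, hc₂, he₂, ht₂⟩ := h₂
  refine ⟨fun x ↦ L₁ x + L₂ x, hc₁.add hc₂, fun x hx ↦ ?_, by simpa using ht₁.add ht₂⟩
  rw [Complex.exp_add, mul_assoc, he₂ x hx, he₁ x hx]

theorem hasLogQuotient_of_norm_sub_lt {K : Set ℂ} {p q : ℂ}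
    (h : ∀ x ∈ K, ‖p - q‖ < ‖x - q‖) : HasLogQuotient K p q := by
  have hne (x) (hx : x ∈ K) : x - q ≠ 0 :=
    norm_pos_iff.1 ((norm_nonneg _).trans_lt (h x hx))
  have hslit (x) (hx : x ∈ K) : 1 + (q - p) / (x - q) ∈ Complex.slitPlane := by
    refine Complex.mem_slitPlane_of_norm_lt_one ?_
    rw [norm_div, div_lt_one (norm_pos_iff.2 (hne x hx)), norm_sub_rev]
    exact h x hx
  refine ⟨fun x ↦ Complex.log (1 + (q - p) / (x - q)), ?_, fun x hx ↦ ?_, ?_⟩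
  · refine ContinuousOn.clog (continuousOn_const.add (continuousOn_const.div ?_ hne)) hslit
    fun_prop
  · rw [Complex.exp_log (Complex.slitPlane_ne_zero (hslit x hx))]
    have := hne x hx
    field_simp
    ring
  · refine Tendsto.mono_left ?_ inf_le_left
    have h1 : Tendsto (fun x : ℂ ↦ x - q) (cocompact ℂ) (cocompact ℂ) :=
      (Homeomorph.subRight q).isClosedEmbedding.tendsto_cocompact
    have h2 : Tendsto (fun x : ℂ ↦ 1 + (q - p) / (x - q)) (cocompact ℂ) (𝓝 1) := by
      simpa [div_eq_mul_inv] using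
        ((((tendsto_inv₀_cobounded' (α := ℂ)).mono_right nhdsWithin_le_nhds).comp
          (by simpa [Metric.cobounded_eq_cocompact] using h1)).const_mul (q - p)).const_add 1
    simpa using h2.clog (by simp)

/-- Two points of a connected open set cannot be told apart by the complement. -/
theorem IsPreconnected.hasLogQuotient {U : Set ℂ} (hU : IsPreconnected U) (hUo : IsOpen U)
    {p q : ℂ} (hp : p ∈ U) (hq : q ∈ U) : HasLogQuotient Uᶜ p q := by
  refine hU.induction₂' (HasLogQuotient Uᶜ) (fun x hx ↦ ?_)
    (fun _ _ _ _ _ _ h₁ h₂ ↦ h₁.trans h₂) hp hq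
  obtain ⟨ε, hε, hball⟩ := Metric.isOpen_iff.1 hUo x hx
  refine eventually_nhdsWithin_of_eventually_nhds ?_
  filter_upwards [ball_mem_nhds x (half_pos hε)] with y hy
  have hy' : ‖y - x‖ < ε / 2 := by simpa [dist_eq_norm] using hy
  have hx' (w) (hw : w ∈ Uᶜ) : ε ≤ ‖w - x‖ := by
    by_contra! hlt
    exact hw (hball (by simpa [dist_eq_norm] using hlt))
  constructor
  · refine hasLogQuotient_of_norm_sub_lt fun w hw ↦ ?_
    have h1 := norm_sub_le_norm_sub_add_norm_sub w y x
    rw [norm_sub_rev x y]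
    linarith [hx' w hw]
  · refine hasLogQuotient_of_norm_sub_lt fun w hw ↦ ?_
    linarith [hx' w hw]

/-- Attaching an arc to a closed set at a single point keeps the logarithm. -/
theorem HasLogQuotient.union_range {K : Set ℂ} (hK : IsClosed K) {p q : ℂ}
    (h : HasLogQuotient K p q) (α : C(unitInterval, ℂ)) (hα : Function.Injective α)
    (hp : p ∉ range α) (hq : q ∉ range α) (h0 : α 0 ∈ K) (hKα : ∀ t, α t ∈ K → t = 0) :
    HasLogQuotient (K ∪ range α) p q := by
  classical
  obtain ⟨L, hLc, hLe, hLt⟩ := h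
  have hpt (t) : α t - p ≠ 0 := fun h ↦ hp ⟨t, sub_eq_zero.1 h⟩
  have hqt (t) : α t - q ≠ 0 := fun h ↦ hq ⟨t, sub_eq_zero.1 h⟩
  have hemb : Topology.IsClosedEmbedding α := α.continuous.isClosedEmbedding hα
  have : ContractibleSpace unitInterval :=
    (convex_Icc (0 : ℝ) 1).contractibleSpace ⟨0, unitInterval.zero_mem⟩
  have : LocallyPathConnectedSpace unitInterval := (convex_Icc (0 : ℝ) 1).locallyPathConnectedSpace
  obtain ⟨l, hl⟩ := exists_continuous_log
    (⟨fun t ↦ (α t - p) / (α t - q), by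
      exact Continuous.div (by fun_prop) (by fun_prop) hqt⟩ : C(unitInterval, ℂ))
    fun t ↦ div_ne_zero (hpt t) (hqt t)
  obtain ⟨M, hM⟩ := ContinuousMap.exists_extension' hemb l
  have hM' (t) : M (α t) = l t := congrFun hM t
  simp only [ContinuousMap.coe_mk] at hl
  let N : ℂ → ℂ := fun x ↦ if x ∈ K then L x else M x - l 0 + L (α 0)
  have hNK : EqOn N L K := fun x hx ↦ if_pos hx
  have hNα : EqOn N (fun x ↦ M x - l 0 + L (α 0)) (range α) := by
    rintro _ ⟨t, rfl⟩
    by_cases ht : α t ∈ K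
    · simp [hKα t ht, hNK h0, hM']
    · exact if_neg ht
  refine ⟨N, (hLc.congr hNK).union_of_isClosed
    (ContinuousOn.congr (by fun_prop) hNα) hK hemb.isClosed_range, ?_, ?_⟩
  · rintro x (hx | ⟨t, rfl⟩)
    · rw [hNK hx, hLe x hx]
    · have h1 : Complex.exp (L (α 0)) = Complex.exp (l 0) := by
        rw [hl, eq_div_iff (hqt 0), hLe _ h0]
      rw [hNα ⟨t, rfl⟩]
      simp only
      rw [hM', Complex.exp_add, h1, ← Complex.exp_add, sub_add_cancel, hl,
        div_mul_cancel₀ _ (hqt t)]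
  · rw [← sup_principal, inf_sup_left, tendsto_sup]
    constructor
    · exact hLt.congr' (mem_inf_of_right (fun x hx ↦ (hNK hx).symm))
    · have : cocompact ℂ ⊓ 𝓟 (range α) = ⊥ := by
        rw [inf_principal_eq_bot]
        exact (isCompact_range α.continuous).compl_mem_cocompact
      simp [this]

/-- A closed set carrying a logarithm of `x ↦ (x - p) / (x - q)` does not separate `p`
from `q`. -/
theorem HasLogQuotient.not_separated {V₁ V₂ : Set ℂ} (hV₁ : IsOpen V₁) (hV₂ : IsOpen V₂)
    (hd : Disjoint V₁ V₂) {p q : ℂ} (hp : p ∈ V₁) (hq : q ∈ V₂) :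
    ¬ HasLogQuotient (V₁ ∪ V₂)ᶜ p q := by
  classical
  rintro ⟨L, hLc, hLe, hLt⟩
  have hqV : q ∉ V₁ := fun h ↦ hd.notMem_of_mem_left h hq
  have hpq : p - q ≠ 0 := sub_ne_zero.2 fun h ↦ hqV (h ▸ hp)
  set C := (V₁ ∪ V₂)ᶜ
  let φ : ℂ → ℂ := fun y ↦ q + y⁻¹
  have hφ : ContinuousOn φ {0}ᶜ :=
    continuousOn_const.add (continuousOn_inv₀.mono fun _ h ↦ h)
  have hopen (V : Set ℂ) (hV : IsOpen V) : IsOpen ({0}ᶜ ∩ φ ⁻¹' V) :=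
    hφ.isOpen_inter_preimage isOpen_compl_singleton hV
  let W : Set ℂ := {0}ᶜ ∩ φ ⁻¹' V₁
  have hWo : IsOpen W := hopen V₁ hV₁
  let C' : Set ℂ := (W ∪ ({0}ᶜ ∩ φ ⁻¹' V₂))ᶜ
  have hC'c : IsClosed C' := (hWo.union (hopen V₂ hV₂)).isClosed_compl
  have hC'mem (y) (hy : y ∈ C') (hy0 : y ≠ 0) : φ y ∈ C := by
    rintro (h | h)
    · exact hy (.inl ⟨hy0, h⟩)
    · exact hy (.inr ⟨hy0, h⟩)
  let L' : ℂ → ℂ := fun y ↦ if y = 0 then 0 else L (φ y)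
  have hL'e (y) (hy : y ∈ C') : Complex.exp (L' y) = 1 - (p - q) * y := by
    by_cases hy0 : y = 0
    · simp [L', hy0]
    · have h1 := hLe _ (hC'mem y hy hy0)
      simp only [L', if_neg hy0]
      simp only [φ, add_sub_cancel_left] at h1 ⊢
      rw [← eq_div_iff (inv_ne_zero hy0)] at h1
      rw [h1]
      field_simp
      ring
  have hL'c : ContinuousOn L' C' := by
    intro y hy
    by_cases hy0 : y = 0
    · subst hy0
      rw [← continuousWithinAt_sdiff_self, ContinuousWithinAt]
      simp only [L', if_true]
      have h1 : Tendsto φ (𝓝[C' \ {0}] 0) (cocompact ℂ ⊓ 𝓟 C) := by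
        refine tendsto_inf.2 ⟨?_, tendsto_principal.2 ?_⟩
        · have h2 : Tendsto (fun y : ℂ ↦ y⁻¹) (𝓝[≠] 0) (cocompact ℂ) := by
            simpa [Metric.cobounded_eq_cocompact] using tendsto_inv₀_nhdsNE_zero (α := ℂ)
          exact ((Homeomorph.addLeft q).isClosedEmbedding.tendsto_cocompact.comp h2).mono_left
            (nhdsWithin_mono _ fun _ h ↦ h.2)
        · filter_upwards [self_mem_nhdsWithin] with y hy using hC'mem y hy.1 hy.2
      refine (hLt.comp h1).congr' ?_
      filter_upwards [self_mem_nhdsWithin] with y hy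
      exact (if_neg hy.2).symm
    · have h1 : ContinuousWithinAt (L ∘ φ) (C' ∩ {0}ᶜ) y :=
        (hLc _ (hC'mem y hy hy0)).comp ((hφ y hy0).mono inter_subset_right)
          fun x hx ↦ hC'mem x hx.1 hx.2
      have h0 : ({0}ᶜ : Set ℂ) ∈ 𝓝 y := isOpen_compl_singleton.mem_nhds hy0
      refine ((continuousWithinAt_inter h0).1 h1).congr_of_eventuallyEq ?_ (if_neg hy0)
      filter_upwards [mem_nhdsWithin_of_mem_nhds h0] with x hx using if_neg hx
  obtain ⟨M, hM⟩ := ContinuousMap.exists_restrict_eq hC'c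
    ⟨C'.domRestrict L', continuousOn_iff_continuous_domRestrict.1 hL'c⟩
  have hM' (y) (hy : y ∈ C') : M y = L' y := congrArg (fun f : C(C', ℂ) ↦ f ⟨y, hy⟩) hM
  have hfr (y) (hy : y ∈ frontier W) : y ∈ C' := by
    rw [hWo.frontier_eq] at hy
    rintro (h | h)
    · exact hy.2 h
    · obtain ⟨x, hx2, hx1⟩ := mem_closure_iff.1 hy.1 _ (hopen V₂ hV₂) h
      exact hd.notMem_of_mem_left hx1.2 hx2.2
  let g : ℂ → ℂ := fun y ↦ if y ∈ W then Complex.exp (M y) else 1 - (p - q) * y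
  have hg : Continuous g := by
    refine Continuous.if (fun y hy ↦ ?_) (by fun_prop) (by fun_prop)
    rw [hM' y (hfr y hy), hL'e y (hfr y hy)]
  obtain ⟨ε, hε, hball⟩ := Metric.isOpen_iff.1 hV₂ q hq
  have hbd (y) (hy : y ∈ W) : ‖y‖ ≤ ε⁻¹ := by
    by_contra! hlt
    refine hd.notMem_of_mem_left hy.2 (hball ?_)
    simpa [φ] using inv_lt_of_inv_lt₀ hε hlt
  obtain ⟨y, hy⟩ := exists_zero_of_eq_affine ⟨g, hg⟩ hpq (R := ε⁻¹)
    fun y hy ↦ if_neg fun h ↦ (hbd y h).not_gt hy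
  simp only [ContinuousMap.coe_mk, g] at hy
  split_ifs at hy with hyW
  · exact Complex.exp_ne_zero _ hy
  · have hy0 : y ≠ 0 := by
      rintro rfl
      simp at hy
    refine hyW ⟨hy0, ?_⟩
    have : φ y = p := by
      simp only [φ]
      field_simp
      linear_combination hy
    rwa [mem_preimage, this]

/-- An arc has no interior points. -/
theorem not_subset_range_of_isOpen {U : Set ℂ} (hU : IsOpen U) (hne : U.Nonempty)
    (α : C(unitInterval, ℂ)) (hα : Function.Injective α) : ¬ U ⊆ range α := by
  intro hsub
  obtain ⟨β, hβ⟩ := ContinuousMap.exists_extension' (α.continuous.isClosedEmbedding hα)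
    (⟨fun t ↦ (t : ℝ), by fun_prop⟩ : C(unitInterval, ℝ))
  have hβ' (t) : β (α t) = t := congrFun hβ t
  obtain ⟨x, hx⟩ := hne
  obtain ⟨ε, hε, hball⟩ := Metric.isOpen_iff.1 hU x hx
  let v : ℝ → ℂ := fun θ ↦ (ε / 2 : ℝ) * Complex.exp (θ * Complex.I)
  have hv (θ) : ‖v θ‖ = ε / 2 := by
    rw [norm_mul, Complex.norm_exp_ofReal_mul_I, Complex.norm_real, mul_one, Real.norm_eq_abs,
      abs_of_pos (half_pos hε)]
  have hvπ : v Real.pi = -v 0 := by simp [v]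
  let h : ℝ → ℝ := fun θ ↦ β (x + v θ) - β (x - v θ)
  have hc : Continuous h := by fun_prop
  have hneg : h Real.pi = -h 0 := by simp [h, hvπ, sub_eq_add_neg]
  obtain ⟨θ, -, hθ⟩ : (0 : ℝ) ∈ h '' uIcc 0 Real.pi := by
    refine intermediate_value_uIcc hc.continuousOn ?_
    rw [hneg, mem_uIcc]
    rcases le_total (h 0) 0 with h | h
    · exact .inl ⟨h, by linarith⟩
    · exact .inr ⟨by linarith, h⟩
  obtain ⟨s, hs⟩ := hsub (hball (show x + v θ ∈ ball x ε by simp [hv]; linarith))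
  obtain ⟨t, ht⟩ := hsub (hball (show x - v θ ∈ ball x ε by simp [hv]; linarith))
  have hst : s = t := by
    refine Subtype.ext ?_
    rw [← hβ', ← hβ', hs, ht]
    exact sub_eq_zero.1 hθ
  have h0 : v θ = 0 := by
    rw [hst, ht] at hs
    linear_combination (-1 / 2 : ℂ) * hs
  have := hv θ
  rw [h0, norm_zero] at this
  linarith

/-- Removing from a connected open set `U` of the complex plane an arc that lies in `U` except
for one endpoint leaves a connected set. -/
theorem IsConnected.diff_range {U : Set ℂ} (hU : IsConnected U) (hUo : IsOpen U)
    (α : C(unitInterval, ℂ)) (hα : Function.Injective α) (h0 : α 0 ∉ U)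
    (hmem : ∀ t, t ≠ 0 → α t ∈ U) : IsConnected (U \ range α) := by
  have hWo : IsOpen (U \ range α) := hUo.sdiff (isCompact_range α.continuous).isClosed
  refine ⟨sdiff_nonempty.2 (not_subset_range_of_isOpen hUo hU.nonempty α hα), ?_⟩
  rw [isPreconnected_iff_subset_of_disjoint]
  intro V₁ V₂ hV₁ hV₂ hcov hdisj
  by_contra! hcon
  obtain ⟨⟨q, hq, hq₁⟩, ⟨p, hp, hp₂⟩⟩ : (∃ q ∈ U \ range α, q ∉ V₁) ∧ ∃ p ∈ U \ range α, p ∉ V₂ :=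
    ⟨not_subset.1 hcon.1, not_subset.1 hcon.2⟩
  have hlog := (hU.isPreconnected.hasLogQuotient hUo hp.1 hq.1).union_range hUo.isClosed_compl α hα
    hp.2 hq.2 h0 fun t ht ↦ by_contra fun h ↦ ht (hmem t h)
  refine HasLogQuotient.not_separated (hWo.inter hV₁) (hWo.inter hV₂) ?_
    ⟨hp, (hcov hp).resolve_right hp₂⟩ ⟨hq, (hcov hq).resolve_left hq₁⟩ ?_
  · rw [disjoint_iff_inter_eq_empty, ← inter_inter_distrib_left, hdisj]
  · rwa [← inter_union_distrib_left, inter_eq_left.2 hcov, sdiff_eq, compl_inter, compl_compl]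

theorem stmt_2 (U : Set Plane) (hUopen : IsOpen U) (hUconn : IsConnected U)
    (z : Plane) (hz : z ∈ frontier U)
    (α : ℝ → Plane)
    (hcont : ContinuousOn α (Icc 0 1))
    (hinj : InjOn α (Icc 0 1))
    (h0 : α 0 = z)
    (hrest : α '' Ioc 0 1 ⊆ U) :
    IsConnected (U \ α '' Icc 0 1) := by
  let e : ℂ ≃ₜ Plane := Complex.orthonormalBasisOneI.repr.toHomeomorph
  have hzU : z ∉ U := fun h ↦ (hUopen.frontier_eq ▸ hz).2 h
  let γ : C(unitInterval, ℂ) := ⟨fun t ↦ e.symm (α t),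
    e.symm.continuous.comp (continuousOn_iff_continuous_domRestrict.1 hcont)⟩
  have key : IsConnected (e ⁻¹' U \ range γ) := by
    refine IsConnected.diff_range ?_ (hUopen.preimage e.continuous) γ ?_ ?_ ?_
    · exact e.isConnected_preimage.2 hUconn
    · intro s t hst
      exact Subtype.ext (hinj s.2 t.2 (e.symm.injective hst))
    · simpa [γ, h0] using hzU
    · intro t ht
      have : α t ∈ U :=
        hrest ⟨t, ⟨lt_of_le_of_ne t.2.1 fun h ↦ ht (Subtype.ext h.symm), t.2.2⟩, rfl⟩
      simpa [γ] using this
  have himage : U \ α '' Icc 0 1 = e '' (e ⁻¹' U \ range γ) := by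
    have hγ : e '' range γ = α '' Icc 0 1 := by
      rw [← range_comp, ← Subtype.range_coe (s := Icc (0 : ℝ) 1), ← range_comp]
      congr 1
      ext t : 1
      simp [γ]
    rw [image_sdiff e.injective, image_preimage_eq _ e.surjective, hγ]
  rw [himage]
  exact key.image e e.continuous.continuousOn
end
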